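/- arXiv:1405.2572 — 12 statements merged into one kernel-verified Lean document; each statement's English description precedes it below -/
import Mathlib

section
/- Let G be a DAG on a finite node set V with disjoint node subsets X, Y and Z, and let W = V \ An(X ∪ Y ∪ Z). Then X and Y are d-separated by Z if and only if there exist sets of nodes U and V' such that {U, V', Z, W} is a partition of V, X ⊆ U, Y ⊆ V', and m(U) ∩ m(V') ⊆ W. -/
open scoped Classical

noncomputable section

/-- A directed graph (edge relation) is acyclic: no directed cycle, i.e. no node is
reachable from itself by a nonempty directed path.  (This implies irreflexivity.) -/
def IsAcyclic {V : Type} (E : V → V → Prop) : Prop :=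
  ∀ v, ¬ Relation.TransGen E v v

/-- `m S`: the union of `S` with the set of all children of nodes of `S`. -/
def mSet {V : Type} (E : V → V → Prop) (S : Set V) : Set V :=
  S ∪ {v | ∃ u ∈ S, E u v}

/-- `An S`: the union of `S` with the set of all ancestors of nodes of `S`. -/
def anc {V : Type} (E : V → V → Prop) (S : Set V) : Set V :=
  S ∪ {u | ∃ v ∈ S, Relation.TransGen E u v}

/-- A pseudo-path (relative to a set `W`) from `A` to `B`: a finite sequence of nodes
starting at `A` and ending at `B`, none of which lies in `W`, such that for each
consecutive pair `a, b` the set `m {a} ∩ m {b}` is not contained in `W`. -/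
def IsPseudoPath {V : Type} (E : V → V → Prop) (W : Set V) (A B : V) (l : List V) : Prop :=
  l.head? = some A ∧ l.getLast? = some B ∧ (∀ v ∈ l, v ∉ W) ∧
    l.Chain' (fun a b => ¬ (mSet E {a} ∩ mSet E {b} ⊆ W))

/-- `X` and `Y` are d-separated by `Z`: with `W = V \ An (X ∪ Y ∪ Z)`, every pseudo-path
from a node of `X` to a node of `Y` contains a node of `Z`. -/
def DSep {V : Type} (E : V → V → Prop) (X Y Z : Set V) : Prop :=
  ∀ A ∈ X, ∀ B ∈ Y, ∀ l : List V,
    IsPseudoPath E (Set.univ \ anc E (X ∪ Y ∪ Z)) A B l → ∃ v ∈ l, v ∈ Z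

theorem mem_mSet_singleton_of_mem_mSet {V : Type} {E : V → V → Prop} {S : Set V} {v : V}
    (hv : v ∈ mSet E S) : ∃ u ∈ S, v ∈ mSet E {u} := by
  rcases hv with hv | ⟨u, hu, huv⟩
  · exact ⟨v, hv, Or.inl rfl⟩
  · exact ⟨u, hu, Or.inr ⟨u, rfl, huv⟩⟩

theorem mSet_mono {V : Type} {E : V → V → Prop} {S T : Set V} (h : S ⊆ T) :
    mSet E S ⊆ mSet E T := by
  rintro v (hv | ⟨u, hu, huv⟩)
  · exact Or.inl (h hv)
  · exact Or.inr ⟨u, h hu, huv⟩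

theorem subset_anc {V : Type} (E : V → V → Prop) (S : Set V) : S ⊆ anc E S :=
  Set.subset_union_left

theorem isPseudoPath_singleton {V : Type} {E : V → V → Prop} {W : Set V} {A : V} (hA : A ∉ W) :
    IsPseudoPath E W A A [A] :=
  ⟨rfl, rfl, by simpa using hA, List.IsChain.singleton A⟩

theorem IsPseudoPath.concat {V : Type} {E : V → V → Prop} {W : Set V} {A B C : V} {l : List V}
    (h : IsPseudoPath E W A B l) (hC : C ∉ W) (hBC : ¬ (mSet E {B} ∩ mSet E {C} ⊆ W)) :
    IsPseudoPath E W A C (l ++ [C]) := by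
  obtain ⟨hA, hB, hW, hl⟩ := h
  refine ⟨by simp [hA], by simp, ?_, ?_⟩
  · intro v hv
    rcases List.mem_append.1 hv with hv | hv
    · exact hW v hv
    · rwa [List.mem_singleton.1 hv]
  · refine List.IsChain.append hl (List.IsChain.singleton C) fun x hx y hy => ?_
    rw [hB] at hx
    obtain rfl : B = x := by simpa using hx
    obtain rfl : C = y := by simpa using hy
    exact hBC

/-- A chain that starts in `U` ends in `U` if `U` is closed under the steps of the chain. -/
theorem List.IsChain.getLast_mem_of_closed {α : Type*} {R : α → α → Prop} {U : Set α}
    {l : List α} (hl : l.IsChain R) (hU : ∀ a ∈ U, ∀ b ∈ l, R a b → b ∈ U) {A B : α}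
    (hA : l.head? = some A) (hB : l.getLast? = some B) (hAU : A ∈ U) : B ∈ U := by
  induction hl generalizing A with
  | nil => simp at hA
  | singleton a => simp_all
  | @cons_cons a b l hab _ ih =>
    obtain rfl : a = A := by simpa using hA
    exact ih (fun x hx y hy => hU x hx y (List.mem_cons_of_mem _ hy)) rfl
      (by simpa [List.getLast?_cons_cons] using hB) (hU a hAU b (by simp) hab)

/-- Let `G` be a DAG on a finite node set with disjoint node subsets
`X`, `Y`, `Z`, and let `W = V \ An(X ∪ Y ∪ Z)`.  Then `X` and `Y` are d-separated by `Z`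
iff there exist sets `U`, `V'` such that `{U, V', Z, W}` is a partition of the node set,
`X ⊆ U`, `Y ⊆ V'`, and `m(U) ∩ m(V') ⊆ W`. -/
theorem stmt0 {V : Type} [Fintype V] (E : V → V → Prop) (hE : IsAcyclic E)
    (X Y Z : Set V) (hXY : Disjoint X Y) (hXZ : Disjoint X Z) (hYZ : Disjoint Y Z)
    (W : Set V) (hW : W = Set.univ \ anc E (X ∪ Y ∪ Z)) :
    DSep E X Y Z ↔
      ∃ U V' : Set V,
        (U ∪ V' ∪ Z ∪ W = Set.univ) ∧
        Disjoint U V' ∧ Disjoint U Z ∧ Disjoint U W ∧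
        Disjoint V' Z ∧ Disjoint V' W ∧ Disjoint Z W ∧
        X ⊆ U ∧ Y ⊆ V' ∧
        mSet E U ∩ mSet E V' ⊆ W := by
  subst hW
  set W := Set.univ \ anc E (X ∪ Y ∪ Z) with hW
  have not_mem_W : ∀ v ∈ X ∪ Y ∪ Z, v ∉ W := fun v hv hvW => hvW.2 (subset_anc E _ hv)
  constructor
  · intro hsep
    let U : Set V := {b | ∃ A ∈ X, ∃ l, IsPseudoPath E W A b l ∧ ∀ v ∈ l, v ∉ Z}
    have hUl : ∀ b ∈ U, b ∉ Z ∧ b ∉ W := by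
      rintro b ⟨A, -, l, hl, hlZ⟩
      have hb := List.mem_of_getLast? hl.2.1
      exact ⟨hlZ b hb, hl.2.2.1 b hb⟩
    refine ⟨U, {v | v ∉ U ∧ v ∉ Z ∧ v ∉ W}, ?_, ?_, ?_, ?_, ?_, ?_, ?_, ?_, ?_, ?_⟩
    · ext v
      simp only [Set.mem_union, Set.mem_ofPred_eq, Set.mem_univ, iff_true]
      tauto
    · exact Set.disjoint_left.2 fun v hv hv' => hv'.1 hv
    · exact Set.disjoint_left.2 fun v hv => (hUl v hv).1
    · exact Set.disjoint_left.2 fun v hv => (hUl v hv).2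
    · exact Set.disjoint_left.2 fun v hv => hv.2.1
    · exact Set.disjoint_left.2 fun v hv => hv.2.2
    · exact Set.disjoint_left.2 fun v hv => not_mem_W v (Or.inr hv)
    · intro A hA
      refine ⟨A, hA, [A], isPseudoPath_singleton (not_mem_W A (Or.inl (Or.inl hA))), ?_⟩
      simpa using Set.disjoint_left.1 hXZ hA
    · intro B hB
      refine ⟨?_, Set.disjoint_left.1 hYZ hB, not_mem_W B (Or.inl (Or.inr hB))⟩
      rintro ⟨A, hA, l, hl, hlZ⟩
      obtain ⟨v, hv, hvZ⟩ := hsep A hA B hB l hl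
      exact hlZ v hv hvZ
    · rintro v ⟨hvU, hvV⟩
      obtain ⟨u, ⟨A, hA, l, hl, hlZ⟩, huv⟩ := mem_mSet_singleton_of_mem_mSet hvU
      obtain ⟨w, ⟨hwU, hwZ, hwW⟩, hwv⟩ := mem_mSet_singleton_of_mem_mSet hvV
      by_contra hvW
      refine hwU ⟨A, hA, l ++ [w], hl.concat hwW fun h => hvW (h ⟨huv, hwv⟩), ?_⟩
      intro x hx
      rcases List.mem_append.1 hx with hx | hx
      · exact hlZ x hx
      · rwa [List.mem_singleton.1 hx]
  · rintro ⟨U, V', hcover, hUV, -, -, -, -, -, hXU, hYV, hm⟩ A hA B hB l ⟨hlA, hlB, hlW, hl⟩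
    by_contra! hlZ
    refine Set.disjoint_left.1 hUV ?_ (hYV hB)
    refine List.IsChain.getLast_mem_of_closed hl (fun a ha b hb hab => ?_) hlA hlB (hXU hA)
    have hbcover : b ∈ U ∪ V' ∪ Z ∪ W := hcover ▸ Set.mem_univ b
    rcases hbcover with ((hbU | hbV) | hbZ) | hbW
    · exact hbU
    · exact absurd ((Set.inter_subset_inter (mSet_mono (Set.singleton_subset_iff.2 ha))
        (mSet_mono (Set.singleton_subset_iff.2 hbV))).trans hm) hab
    · exact absurd hbZ (hlZ b hb)
    · exact absurd hbW (hlW b hb)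
end
end

section
/- Let G be a DAG on a finite node set V, with each node carrying a nonempty finite value set, let X, Y, Z be disjoint subsets of V, and let P be a joint probability distribution over all nodes that is Markov relative to G. If X and Y are d-separated by Z in G, then (X ⊥ Y | Z)_P holds. -/
open scoped Classical

noncomputable section

/-- `p` is a probability distribution on the finite type `α`. -/
def IsProbDist {α : Type} [Fintype α] (p : α → ℝ) : Prop :=
  (∀ a, 0 ≤ p a) ∧ ∑ a, p a = 1

/-- The marginal probability, under the joint distribution `P`, of the value
assignment `x` on the set of nodes `S`. -/
noncomputable def margin {V : Type} [Fintype V] {Ω : V → Type} [∀ i, Fintype (Ω i)]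
    (P : (∀ i, Ω i) → ℝ) (S : Set V) (x : ∀ i : S, Ω i) : ℝ :=
  ∑ g : ∀ i, Ω i, if ∀ i : S, g i = x i then P g else 0

/-- `P` is Markov relative to the directed graph `E`: there are stochastic kernels `k i`,
assigning to each value assignment on the parents of `i` a probability distribution on
`Ω i`, with `P g = ∏ i, k i (g restricted to pa i) (g i)` for every `g`. -/
def IsMarkov {V : Type} [Fintype V] (E : V → V → Prop) (Ω : V → Type)
    [∀ i, Fintype (Ω i)] (P : (∀ i, Ω i) → ℝ) : Prop :=
  ∃ k : ∀ i : V, (∀ j : {j : V // E j i}, Ω j) → Ω i → ℝ,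
    (∀ i pa x, 0 ≤ k i pa x) ∧
    (∀ i pa, ∑ x, k i pa x = 1) ∧
    (∀ g : ∀ i, Ω i, P g = ∏ i, k i (fun j => g j.1) (g i))

/-- Conditional independence `(X ⊥ Y | Z)_P`: for all value assignments on the
(disjoint) sets `X`, `Y`, `Z` we have `P(x,y,z)·P(z) = P(x,z)·P(y,z)`.  (Since all value
sets are nonempty, quantifying over full assignments `g` and restricting is
equivalent.) -/
def CondIndep {V : Type} [Fintype V] {Ω : V → Type} [∀ i, Fintype (Ω i)]
    (P : (∀ i, Ω i) → ℝ) (X Y Z : Set V) : Prop :=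
  ∀ g : ∀ i, Ω i,
    margin P (X ∪ Y ∪ Z) (fun i => g i) * margin P Z (fun i => g i) =
      margin P (X ∪ Z) (fun i => g i) * margin P (Y ∪ Z) (fun i => g i)

/-- Summing over a configuration and over a fresh value at `w` counts every configuration
`card (Ω w)` times. -/
lemma sum_sum_update {V : Type} [Fintype V] {Ω : V → Type} [∀ i, Fintype (Ω i)]
    (w : V) (H : (∀ i, Ω i) → ℝ) :
    ∑ g, ∑ x : Ω w, H (Function.update g w x) = Fintype.card (Ω w) * ∑ g, H g := by
  have h : ∑ p : (∀ i, Ω i) × Ω w, H (Function.update p.1 w p.2) =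
      ∑ p : (∀ i, Ω i) × Ω w, H p.1 := by
    refine Finset.sum_nbij' (fun p => (Function.update p.1 w p.2, p.1 w))
      (fun p => (Function.update p.1 w p.2, p.1 w)) ?_ ?_ ?_ ?_ ?_ <;> simp
  rw [Fintype.sum_prod_type, Fintype.sum_prod_type] at h
  simpa [Finset.mul_sum] using h

/-- A factor may be replaced by another one with the same sums over the coordinate `w`, provided
the remaining factor does not depend on that coordinate. -/
lemma sum_mul_congr_of_update {V : Type} [Fintype V] {Ω : V → Type} [∀ i, Fintype (Ω i)]
    [∀ i, Nonempty (Ω i)] (w : V) (F a b : (∀ i, Ω i) → ℝ)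
    (hF : ∀ g x, F (Function.update g w x) = F g)
    (hab : ∀ g, ∑ x, a (Function.update g w x) = ∑ x, b (Function.update g w x)) :
    ∑ g, F g * a g = ∑ g, F g * b g := by
  have hc : (Fintype.card (Ω w) : ℝ) ≠ 0 := by simp
  apply mul_left_cancel₀ hc
  rw [← sum_sum_update w, ← sum_sum_update w]
  refine Finset.sum_congr rfl fun g _ => ?_
  simp only [hF, ← Finset.mul_sum, hab]

/-- In an acyclic finite graph, every nonempty set has a member none of whose parents
lie in the set. -/
lemma IsAcyclic.exists_source {V : Type} [Fintype V] {E : V → V → Prop} (hE : IsAcyclic E)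
    (S : Set V) (hS : S.Nonempty) : ∃ w ∈ S, ∀ j, E j w → j ∉ S := by
  have : Std.Irrefl (Relation.TransGen E) := ⟨hE⟩
  have hwf : WellFounded (Relation.TransGen E) := Finite.wellFounded_of_trans_of_irrefl _
  obtain ⟨w, hw, hmin⟩ := hwf.has_min S hS
  exact ⟨w, hw, fun j hj hjS => hmin j hjS (.single hj)⟩

/-- For a function of the coordinates in a parent-closed set `B`, the kernels outside `B` may be
replaced by uniform distributions in its expectation. -/
lemma sum_mul_prod_eq_of_parentClosed {V : Type} [Fintype V] {E : V → V → Prop}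
    (hE : IsAcyclic E) {Ω : V → Type} [∀ i, Fintype (Ω i)] [∀ i, Nonempty (Ω i)]
    (κ : V → (∀ i, Ω i) → ℝ)
    (hloc : ∀ i g h, (∀ j, j = i ∨ E j i → g j = h j) → κ i g = κ i h)
    (hsum : ∀ i g, ∑ x, κ i (Function.update g i x) = 1)
    (B : Finset V) (hB : ∀ i ∈ B, ∀ j, E j i → j ∈ B)
    (φ : (∀ i, Ω i) → ℝ) (hφ : ∀ g h, (∀ j ∈ B, g j = h j) → φ g = φ h) :
    ∑ g, φ g * ∏ i, κ i g =
      ∑ g, φ g * ∏ i, if i ∈ B then κ i g else (Fintype.card (Ω i) : ℝ)⁻¹ := by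
  induction hn : Bᶜ.card generalizing B with
  | zero =>
    have hB' : B = Finset.univ := by simpa using hn
    simp [hB']
  | succ n ih =>
    obtain ⟨w, hw, hwE⟩ := hE.exists_source (↑(Bᶜ) : Set V)
      (Finset.coe_nonempty.2 (Finset.card_pos.1 (by omega)))
    have hwB : w ∉ B := by simpa using hw
    rw [ih (insert w B)]
    · have split : ∀ (C : Finset V) (g : ∀ i, Ω i),
          φ g * ∏ i, (if i ∈ C then κ i g else (Fintype.card (Ω i) : ℝ)⁻¹) =
          (φ g * ∏ i ∈ Finset.univ.erase w,
            if i ∈ C then κ i g else (Fintype.card (Ω i) : ℝ)⁻¹) *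
            (if w ∈ C then κ w g else (Fintype.card (Ω w) : ℝ)⁻¹) := by
        intro C g
        rw [mul_assoc, Finset.prod_erase_mul _ _ (Finset.mem_univ w)]
      simp only [split]
      have hprod : ∀ g : ∀ i, Ω i, (∏ i ∈ Finset.univ.erase w,
            if i ∈ insert w B then κ i g else (Fintype.card (Ω i) : ℝ)⁻¹) =
          ∏ i ∈ Finset.univ.erase w,
            if i ∈ B then κ i g else (Fintype.card (Ω i) : ℝ)⁻¹ := by
        intro g
        refine Finset.prod_congr rfl fun i hi => ?_
        simp [Finset.ne_of_mem_erase hi]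
      simp only [hprod]
      refine sum_mul_congr_of_update w _ _ _ (fun g x => ?_) fun g => ?_
      · congr 1
        · refine hφ _ _ fun j hj => ?_
          rw [Function.update_of_ne (by rintro rfl; exact hwB hj)]
        · refine Finset.prod_congr rfl fun i _ => ?_
          split_ifs with hi
          · refine hloc _ _ _ fun j hj => ?_
            have hj' : j ∈ B := by
              rcases hj with rfl | hj
              exacts [hi, hB i hi j hj]
            rw [Function.update_of_ne (by rintro rfl; exact hwB hj')]
          · rfl
      · simp [hwB, hsum]
    · intro i hi j hj
      rcases Finset.mem_insert.1 hi with rfl | hi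
      · have := hwE j hj
        simp at this
        simp [this]
      · exact Finset.mem_insert_of_mem (hB i hi j hj)
    · exact fun g h hgh => hφ g h fun j hj => hgh j (Finset.mem_insert_of_mem hj)
    · rw [Finset.compl_insert, Finset.card_erase_of_mem (by simpa using hwB), hn]
      rfl

/-- A function which factorizes into a function of the coordinates in `R ∪ Z` and a function of
the coordinates outside `R` makes `X ⊆ R` and `Y ⊆ Rᶜ` conditionally independent given `Z`. -/
lemma condIndep_of_factorization {V : Type} [Fintype V] {Ω : V → Type} [∀ i, Fintype (Ω i)]
    (Q α β : (∀ i, Ω i) → ℝ) (X Y Z R : Set V) (hX : X ⊆ R) (hY : Disjoint Y R)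
    (hZ : Disjoint Z R) (hQ : ∀ g, Q g = α g * β g)
    (hα : ∀ g h, (∀ j, j ∈ R ∨ j ∈ Z → g j = h j) → α g = α h)
    (hβ : ∀ g h, (∀ j, j ∉ R → g j = h j) → β g = β h) :
    CondIndep Q X Y Z := by
  intro g₀
  have hY' : ∀ i ∈ Y, i ∉ R := fun _ hi => Set.disjoint_left.1 hY hi
  have hZ' : ∀ i ∈ Z, i ∉ R := fun _ hi => Set.disjoint_left.1 hZ hi
  let mix : (∀ i, Ω i) → (∀ i, Ω i) → ∀ i, Ω i := fun g h i => if i ∈ R then g i else h i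
  have mix_mem : ∀ g h i, i ∈ R → mix g h i = g i := fun g h i hi => if_pos hi
  have mix_not : ∀ g h i, i ∉ R → mix g h i = h i := fun g h i hi => if_neg hi
  have mix_mix : ∀ g h, mix (mix g h) (mix h g) = g := by
    intro g h
    funext i
    by_cases hi : i ∈ R <;> simp [mix, hi]
  simp only [margin, Finset.sum_mul_sum, ← Fintype.sum_prod_type']
  refine Finset.sum_nbij' (fun p => (mix p.1 p.2, mix p.2 p.1))
    (fun p => (mix p.1 p.2, mix p.2 p.1)) (by simp) (by simp)
    (by simp [mix_mix]) (by simp [mix_mix]) ?_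
  rintro ⟨g, h⟩ -
  simp only [Subtype.forall, ite_zero_mul_ite_zero]
  have hiff : ((∀ i ∈ X ∪ Y ∪ Z, g i = g₀ i) ∧ ∀ i ∈ Z, h i = g₀ i) ↔
      (∀ i ∈ X ∪ Z, mix g h i = g₀ i) ∧ ∀ i ∈ Y ∪ Z, mix h g i = g₀ i := by
    constructor
    · rintro ⟨h1, h2⟩
      refine ⟨?_, ?_⟩
      · rintro i (hi | hi)
        · rw [mix_mem _ _ _ (hX hi)]; exact h1 i (.inl (.inl hi))
        · rw [mix_not _ _ _ (hZ' i hi)]; exact h2 i hi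
      · rintro i (hi | hi)
        · rw [mix_not _ _ _ (hY' i hi)]; exact h1 i (.inl (.inr hi))
        · rw [mix_not _ _ _ (hZ' i hi)]; exact h1 i (.inr hi)
    · rintro ⟨h1, h2⟩
      refine ⟨?_, ?_⟩
      · rintro i ((hi | hi) | hi)
        · rw [← mix_mem g h _ (hX hi)]; exact h1 i (.inl hi)
        · rw [← mix_not h g _ (hY' i hi)]; exact h2 i (.inl hi)
        · rw [← mix_not h g _ (hZ' i hi)]; exact h2 i (.inr hi)
      · intro i hi
        rw [← mix_not g h _ (hZ' i hi)]; exact h1 i (.inr hi)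
  refine if_ctx_congr hiff (fun hc => ?_) fun _ => rfl
  obtain ⟨h1, h2⟩ := hiff.2 hc
  have hgh : ∀ i ∈ Z, g i = h i := fun i hi => (h1 i (.inr hi)).trans (h2 i hi).symm
  have e1 : α (mix g h) = α g := hα _ _ fun j hj => by
    rcases hj with hj | hj
    · exact mix_mem _ _ _ hj
    · rw [mix_not _ _ _ (hZ' j hj), hgh j hj]
  have e2 : α (mix h g) = α h := hα _ _ fun j hj => by
    rcases hj with hj | hj
    · exact mix_mem _ _ _ hj
    · rw [mix_not _ _ _ (hZ' j hj), hgh j hj]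
  have e3 : β (mix g h) = β h := hβ _ _ fun j hj => mix_not _ _ _ hj
  have e4 : β (mix h g) = β g := hβ _ _ fun j hj => mix_not _ _ _ hj
  simp only [hQ, e1, e2, e3, e4]
  ring

/-- The nodes joined to a node of `X` by a pseudo-path avoiding `Z`. -/
def pseudoReach {V : Type} (E : V → V → Prop) (W X Z : Set V) : Set V :=
  {v | ∃ a ∈ X, ∃ l, IsPseudoPath E W a v l ∧ ∀ u ∈ l, u ∉ Z}

lemma not_mem_of_mem_pseudoReach {V : Type} {E : V → V → Prop} {W X Z : Set V} {v : V}
    (hv : v ∈ pseudoReach E W X Z) : v ∉ Z := by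
  obtain ⟨a, -, l, ⟨-, hl, -⟩, hZ⟩ := hv
  exact hZ v (List.mem_of_getLast? hl)

lemma mem_pseudoReach_of_mem {V : Type} {E : V → V → Prop} {W X Z : Set V} {v : V}
    (hv : v ∈ X) (hW : v ∉ W) (hZ : v ∉ Z) : v ∈ pseudoReach E W X Z :=
  ⟨v, hv, [v], ⟨rfl, rfl, by simpa using hW, List.isChain_singleton _⟩, by simpa using hZ⟩

lemma mem_pseudoReach_of_step {V : Type} {E : V → V → Prop} {W X Z : Set V} {v b : V}
    (hv : v ∈ pseudoReach E W X Z) (hW : b ∉ W) (hZ : b ∉ Z)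
    (h : ¬ (mSet E {v} ∩ mSet E {b} ⊆ W)) : b ∈ pseudoReach E W X Z := by
  obtain ⟨a, ha, l, ⟨h1, h2, h3, h4⟩, h5⟩ := hv
  refine ⟨a, ha, l ++ [b], ⟨?_, by simp, ?_, ?_⟩, ?_⟩
  · simp [List.head?_append, h1]
  · intro u hu
    rcases List.mem_append.1 hu with hu | hu
    · exact h3 u hu
    · rwa [List.mem_singleton.1 hu]
  · refine List.IsChain.append h4 (List.isChain_singleton _) fun x hx y hy => ?_
    rw [h2] at hx
    simp only [Option.mem_def, Option.some.injEq, List.head?_cons] at hx hy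
    rwa [← hx, ← hy]
  · intro u hu
    rcases List.mem_append.1 hu with hu | hu
    · exact h5 u hu
    · rwa [List.mem_singleton.1 hu]

/-- The ancestral closure of a set is closed under parents. -/
lemma mem_anc_of_edge {V : Type} {E : V → V → Prop} {S : Set V} {i j : V}
    (hi : i ∈ anc E S) (hj : E j i) : j ∈ anc E S := by
  rcases hi with hi | ⟨v, hv, hiv⟩
  · exact .inr ⟨i, hi, .single hj⟩
  · exact .inr ⟨v, hv, .head hj hiv⟩

/-- soundness of d-separation.  If the joint probability distribution
`P` over the nodes of the DAG `G` is Markov relative to `G`, and `X`, `Y`, `Z` are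
disjoint node subsets with `X` and `Y` d-separated by `Z`, then `(X ⊥ Y | Z)_P`. -/
theorem stmt1 {V : Type} [Fintype V] (E : V → V → Prop) (hE : IsAcyclic E)
    {Ω : V → Type} [∀ i, Fintype (Ω i)] [∀ i, Nonempty (Ω i)]
    (X Y Z : Set V) (hXY : Disjoint X Y) (hXZ : Disjoint X Z) (hYZ : Disjoint Y Z)
    (P : (∀ i, Ω i) → ℝ) (hP : IsProbDist P) (hM : IsMarkov E Ω P)
    (hd : DSep E X Y Z) :
    CondIndep P X Y Z := by
  obtain ⟨k, -, hk1, hk2⟩ := hM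
  set A := anc E (X ∪ Y ∪ Z)
  set W : Set V := Set.univ \ A
  have not_W : ∀ i, i ∈ A → i ∉ W := fun i hi h => h.2 hi
  have sub_A : X ∪ Y ∪ Z ⊆ A := Set.subset_union_left
  let κ : V → (∀ i, Ω i) → ℝ := fun i g => k i (fun j => g j.1) (g i)
  have hloc : ∀ i g h, (∀ j, j = i ∨ E j i → g j = h j) → κ i g = κ i h := by
    intro i g h hgh
    have h1 : (fun j : {j : V // E j i} => g j.1) = fun j : {j : V // E j i} => h j.1 :=
      funext fun j => hgh j.1 (.inr j.2)
    simp only [κ, h1, hgh i (.inl rfl)]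
  have hsum : ∀ i g, ∑ x, κ i (Function.update g i x) = 1 := by
    intro i g
    rw [← hk1 i fun j => g j.1]
    refine Finset.sum_congr rfl fun x _ => ?_
    have h1 : (fun j : {j : V // E j i} => Function.update g i x j.1) =
        fun j : {j : V // E j i} => g j.1 := by
      funext j
      have hj : j.1 ≠ i := fun h => hE i (.single (by simpa only [h] using j.2))
      exact Function.update_of_ne hj _ _
    simp only [κ, h1, Function.update_self]
  let Q : (∀ i, Ω i) → ℝ := fun g =>
    ∏ i, if i ∈ A.toFinset then κ i g else (Fintype.card (Ω i) : ℝ)⁻¹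
  have hmargin : ∀ S ⊆ A, ∀ x : ∀ i : S, Ω i, margin P S x = margin Q S x := by
    intro S hS x
    have key := sum_mul_prod_eq_of_parentClosed hE κ hloc hsum A.toFinset
      (fun i hi j hj => Set.mem_toFinset.2 (mem_anc_of_edge (Set.mem_toFinset.1 hi) hj))
      (fun g => if ∀ i : S, g i = x i then 1 else 0)
      (fun g h hgh => by
        have : ∀ i : S, g i = h i := fun i => hgh i (Set.mem_toFinset.2 (hS i.2))
        simp only [this])
    simpa only [margin, hk2, ite_mul, one_mul, zero_mul] using key
  set R := pseudoReach E W X Z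
  have hfam : ∀ i ∈ A, ∀ a b, (a = i ∨ E a i) → (b = i ∨ E b i) → a ∈ R → b ∉ Z → b ∈ R := by
    intro i hi a b ha hb haR hbZ
    refine mem_pseudoReach_of_step haR ?_ hbZ fun h => not_W i hi (h ⟨?_, ?_⟩)
    · rcases hb with rfl | hb
      exacts [not_W _ hi, not_W _ (mem_anc_of_edge hi hb)]
    · simpa [mSet, eq_comm] using ha
    · simpa [mSet, eq_comm] using hb
  have hcond : CondIndep Q X Y Z := by
    refine condIndep_of_factorization Q
      (fun g => ∏ i, if i ∈ A ∧ ∃ a, (a = i ∨ E a i) ∧ a ∈ R then κ i g else 1)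
      (fun g => ∏ i, if i ∈ A then
        (if ∃ a, (a = i ∨ E a i) ∧ a ∈ R then 1 else κ i g) else (Fintype.card (Ω i) : ℝ)⁻¹)
      X Y Z R ?_ ?_ ?_ ?_ ?_ ?_
    · exact fun i hi => mem_pseudoReach_of_mem hi (not_W i (sub_A (.inl (.inl hi))))
        (Set.disjoint_left.1 hXZ hi)
    · rw [Set.disjoint_left]
      rintro b hb ⟨a, ha, l, hl, hlZ⟩
      obtain ⟨v, hv, hvZ⟩ := hd a ha b hb l hl
      exact hlZ v hv hvZ
    · exact Set.disjoint_left.2 fun i hi hiR => not_mem_of_mem_pseudoReach hiR hi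
    · intro g
      rw [← Finset.prod_mul_distrib]
      refine Finset.prod_congr rfl fun i _ => ?_
      by_cases h1 : i ∈ A <;> by_cases h2 : ∃ a, (a = i ∨ E a i) ∧ a ∈ R <;>
        simp only [Set.mem_toFinset, h1, h2, true_and, false_and, if_true, if_false, one_mul,
          mul_one]
    · intro g h hgh
      refine Finset.prod_congr rfl fun i _ => ?_
      split_ifs with hi
      · obtain ⟨hiA, a, ha, haR⟩ := hi
        exact hloc _ _ _ fun j hj => hgh j <| or_iff_not_imp_right.2 (hfam i hiA a j ha hj haR)
      · rfl
    · intro g h hgh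
      refine Finset.prod_congr rfl fun i _ => ?_
      split_ifs with hi hiR
      · rfl
      · exact hloc _ _ _ fun j hj => hgh j fun hjR => hiR ⟨j, hj, hjR⟩
      · rfl
  intro g
  rw [hmargin _ sub_A, hmargin Z fun i hi => sub_A (.inr hi),
    hmargin (X ∪ Z) (Set.union_subset (fun i hi => sub_A (.inl (.inl hi)))
      fun i hi => sub_A (.inr hi)),
    hmargin (Y ∪ Z) (Set.union_subset (fun i hi => sub_A (.inl (.inr hi)))
      fun i hi => sub_A (.inr hi))]
  exact hcond g
end
end

section
/- Let G be a DAG on a finite node set V with nonempty finite value sets, and let W ⊆ V be a set of nodes that contains all descendants of each of its elements. If a joint probability distribution P over all nodes is Markov relative to G, then the marginal distribution of P on the nodes V \ W is Markov relative to the induced subgraph of G on V \ W. -/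
open scoped Classical

noncomputable section

/-- In an acyclic directed graph on a finite node set, every nonempty set of nodes `T` has a
node without parents in `T`. -/
theorem IsAcyclic.exists_source_s3 {V : Type} [Finite V] {E : V → V → Prop} (hE : IsAcyclic E)
    {T : Finset V} (hT : T.Nonempty) : ∃ u ∈ T, ∀ j ∈ T, ¬ E j u := by
  have : Std.Irrefl (Relation.TransGen E) := ⟨hE⟩
  have wf : WellFounded (Relation.TransGen E) := Finite.wellFounded_of_trans_of_irrefl _
  obtain ⟨u, hu, hmin⟩ := wf.has_min (T : Set V) hT
  exact ⟨u, hu, fun j hj h => hmin j hj (.single h)⟩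

/-- Summing a product of stochastic kernels indexed by a set of nodes `T` over all assignments
with prescribed values off `T` gives `1`. -/
theorem sum_prod_kernel_eq_one {V : Type} [Fintype V] {E : V → V → Prop} (hE : IsAcyclic E)
    {Ω : V → Type} [∀ i, Fintype (Ω i)]
    {k : ∀ i : V, (∀ j : {j : V // E j i}, Ω j) → Ω i → ℝ}
    (hk : ∀ i pa, ∑ x, k i pa x = 1) (T : Finset V) (f : ∀ i, Ω i) :
    ∑ g : ∀ i, Ω i, (if ∀ i, i ∉ T → g i = f i then
      ∏ i ∈ T, k i (fun j => g j.1) (g i) else 0) = 1 := by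
  induction T using Finset.strongInduction generalizing f with
  | H T ih =>
    obtain rfl | hT := T.eq_empty_or_nonempty
    · simp [← funext_iff]
    obtain ⟨u, hu, hsrc⟩ := hE.exists_source_s3 hT
    have key (g : ∀ i, Ω i) :
        (if ∀ i, i ∉ T → g i = f i then ∏ i ∈ T, k i (fun j => g j.1) (g i) else 0) =
          ∑ a, k u (fun j => f j.1) a *
            (if ∀ i, i ∉ T.erase u → g i = Function.update f u a i then
              ∏ i ∈ T.erase u, k i (fun j => g j.1) (g i) else 0) := by
      rw [Finset.sum_eq_single (g u)]
      · have hiff : (∀ i, i ∉ T.erase u → g i = Function.update f u (g u) i) ↔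
            ∀ i, i ∉ T → g i = f i := by
          refine forall_congr' fun i => ?_
          obtain rfl | hi := eq_or_ne i u
          · simp [hu]
          · simp [hi]
        simp only [hiff]
        split_ifs with h
        · rw [← Finset.mul_prod_erase T _ hu]
          have hpa : (fun j : {j // E j u} => g j.1) = fun j : {j // E j u} => f j.1 :=
            funext fun j => h j.1 fun hj => hsrc j.1 hj j.2
          rw [hpa]
        · simp
      · intro a _ ha
        rw [if_neg, mul_zero]
        intro h
        have := h u (Finset.notMem_erase u T)
        rw [Function.update_self] at this
        exact ha this.symm
      · simp
    simp_rw [key]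
    rw [Finset.sum_comm]
    simp_rw [← Finset.mul_sum, ih _ (Finset.erase_ssubset hu), mul_one, hk]

/-- Let `W` be a set of nodes of the DAG `G` that contains all
descendants of each of its elements.  If the joint probability distribution `P` is
Markov relative to `G`, then the marginal of `P` on the nodes not in `W` is Markov
relative to the induced subgraph of `G` on those nodes. -/
theorem stmt3 {V : Type} [Fintype V] [DecidableEq V] (E : V → V → Prop)
    (hE : IsAcyclic E)
    {Ω : V → Type} [∀ i, Fintype (Ω i)] [∀ i, Nonempty (Ω i)]
    (W : Set V) (hW : ∀ u ∈ W, ∀ v, Relation.TransGen E u v → v ∈ W)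
    (P : (∀ i, Ω i) → ℝ) (hP : IsProbDist P) (hM : IsMarkov E Ω P) :
    IsMarkov (fun a b : {v : V // v ∉ W} => E a.1 b.1) (fun i => Ω i.1)
      (fun x => margin P {v | v ∉ W} (fun i => x ⟨i.1, i.2⟩)) := by
  obtain ⟨k, hk0, hk1, hPk⟩ := hM
  have hpa (i : {v : V // v ∉ W}) (j : {j : V // E j i.1}) : j.1 ∉ W :=
    fun hj => i.2 (hW j.1 hj i.1 (.single j.2))
  refine ⟨fun i pa => k i.1 fun j => pa ⟨⟨j.1, hpa i j⟩, j.2⟩, fun _ _ _ => hk0 _ _ _,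
    fun _ _ => hk1 _ _, fun x => ?_⟩
  let f : ∀ i, Ω i := fun i => if h : i ∉ W then x ⟨i, h⟩ else Classical.arbitrary _
  have hf (i : {v : V // v ∉ W}) : f i.1 = x i := dif_pos i.2
  let T : Finset V := Finset.univ.filter (· ∈ W)
  have hT (i : V) : i ∉ T ↔ i ∉ W := by simp [T]
  rw [← mul_one (∏ i, _), ← sum_prod_kernel_eq_one hE hk1 T f, Finset.mul_sum]
  refine Finset.sum_congr rfl fun g _ => ?_
  have hiff : (∀ i : {v | v ∉ W}, g i = x ⟨i.1, i.2⟩) ↔ ∀ i, i ∉ T → g i = f i :=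
    ⟨fun h i hi => (h ⟨i, (hT i).1 hi⟩).trans (hf ⟨i, (hT i).1 hi⟩).symm,
      fun h i => (h i.1 ((hT i.1).2 i.2)).trans (hf ⟨i.1, i.2⟩)⟩
  by_cases h : ∀ i, i ∉ T → g i = f i
  · rw [if_pos (hiff.2 h), if_pos h, hPk, ← Finset.prod_compl_mul_prod T]
    congr 1
    rw [Finset.prod_subtype (p := fun v => v ∉ W) Tᶜ (fun i => by simp [T])]
    have hg (i : {v : V // v ∉ W}) : g i.1 = x i := hiff.2 h ⟨i.1, i.2⟩
    refine Finset.prod_congr rfl fun i _ => ?_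
    rw [hg i]
    congr 1
    exact funext fun j => hg ⟨j.1, hpa i j⟩
  · rw [if_neg (mt hiff.1 h), if_neg h, mul_zero]
end
end

section
/- Let G be a DAG on a finite node set with nonempty finite value sets, and let X, Y, Z be disjoint sets of nodes. Suppose the node set can be partitioned into three sets {U, V', Z} such that X ⊆ U, Y ⊆ V', and m(U) ∩ m(V') = ∅. Then (X ⊥ Y | Z)_P holds for every joint probability distribution P that is Markov relative to G. -/
open scoped Classical

noncomputable section

/-- If `P` factors as `a * b`, where `a` does not depend on the coordinates in `T` and `b` depends
only on the coordinates in `T ∪ Z`, then sets of coordinates `X` outside `T` and `Y` inside `T` are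
conditionally independent given a set `Z` outside `T`. -/
theorem condIndep_of_factorization_s4 {V : Type} [Fintype V] {Ω : V → Type} [∀ i, Fintype (Ω i)]
    {P a b : (∀ i, Ω i) → ℝ} {X Y Z T : Set V} (hP : ∀ g, P g = a g * b g)
    (ha : ∀ g h, (∀ i ∉ T, g i = h i) → a g = a h)
    (hb : ∀ g h, (∀ i ∈ T ∪ Z, g i = h i) → b g = b h)
    (hX : ∀ i ∈ X, i ∉ T) (hY : Y ⊆ T) (hZ : ∀ i ∈ Z, i ∉ T) :
    CondIndep P X Y Z := by
  intro g
  let σ : ((∀ i, Ω i) × (∀ i, Ω i)) → ((∀ i, Ω i) × (∀ i, Ω i)) := fun p =>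
    (fun i => if i ∈ T then p.2 i else p.1 i, fun i => if i ∈ T then p.1 i else p.2 i)
  have hσ : Function.Involutive σ := by
    rintro ⟨p, q⟩
    ext i <;> by_cases hi : i ∈ T <;> simp [σ, hi]
  simp only [margin]
  rw [Finset.sum_mul_sum, Finset.sum_mul_sum, ← Finset.sum_product', ← Finset.sum_product']
  refine Fintype.sum_equiv (hσ.toPerm σ) _ _ ?_
  rintro ⟨p, q⟩
  have hfst : ∀ i ∉ T, (σ (p, q)).1 i = p i := fun i hi => by simp [σ, hi]
  have hfst' : ∀ i ∈ T, (σ (p, q)).1 i = q i := fun i hi => by simp [σ, hi]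
  have hsnd : ∀ i ∉ T, (σ (p, q)).2 i = q i := fun i hi => by simp [σ, hi]
  have hsnd' : ∀ i ∈ T, (σ (p, q)).2 i = p i := fun i hi => by simp [σ, hi]
  rw [Function.Involutive.coe_toPerm]
  generalize σ (p, q) = r at *
  obtain ⟨r, s⟩ := r
  simp only at *
  rw [ite_zero_mul_ite_zero, ite_zero_mul_ite_zero]
  have hiff : ((∀ i : ↥(X ∪ Y ∪ Z), p i = g i) ∧ ∀ i : ↥Z, q i = g i) ↔
      ((∀ i : ↥(X ∪ Z), r i = g i) ∧ ∀ i : ↥(Y ∪ Z), s i = g i) := by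
    simp only [Subtype.forall, Set.mem_union]
    grind
  by_cases h : (∀ i : ↥(X ∪ Y ∪ Z), p i = g i) ∧ ∀ i : ↥Z, q i = g i
  · rw [if_pos h, if_pos (hiff.mp h), hP, hP, hP, hP, ha r p hfst, ha s q hsnd, hb r q, hb s p]
    · ring
    all_goals
      obtain ⟨h₁, h₂⟩ := h
      simp only [Subtype.forall, Set.mem_union] at *
      grind
  · rw [if_neg h, if_neg (hiff.not.mp h)]

/-- Suppose the node set of the DAG `G` can be partitioned into
`{U, V', Z}` with `X ⊆ U`, `Y ⊆ V'` and `m(U) ∩ m(V') = ∅`, where `X`, `Y`, `Z` are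
disjoint.  Then `(X ⊥ Y | Z)_P` for every joint probability distribution `P` that is
Markov relative to `G`. -/
theorem stmt4 {V : Type} [Fintype V] (E : V → V → Prop) (hE : IsAcyclic E)
    {Ω : V → Type} [∀ i, Fintype (Ω i)] [∀ i, Nonempty (Ω i)]
    (X Y Z U V' : Set V)
    (hXY : Disjoint X Y) (hXZ : Disjoint X Z) (hYZ : Disjoint Y Z)
    (hcover : U ∪ V' ∪ Z = Set.univ)
    (hUV : Disjoint U V') (hUZ : Disjoint U Z) (hVZ : Disjoint V' Z)
    (hXU : X ⊆ U) (hYV : Y ⊆ V')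
    (hm : mSet E U ∩ mSet E V' = ∅)
    (P : (∀ i, Ω i) → ℝ) (hP : IsProbDist P) (hM : IsMarkov E Ω P) :
    CondIndep P X Y Z := by
  obtain ⟨k, -, -, hk⟩ := hM
  refine condIndep_of_factorization_s4 (T := V')
    (a := fun g => ∏ i with i ∈ mSet E U, k i (fun j => g j.1) (g i))
    (b := fun g => ∏ i with i ∉ mSet E U, k i (fun j => g j.1) (g i))
    (fun g => (hk g).trans (Finset.prod_filter_mul_prod_filter_not _ _ _).symm) ?_ ?_
    (fun i hi => Set.disjoint_left.mp hUV (hXU hi)) hYV (fun i hi => Set.disjoint_right.mp hVZ hi)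
  · intro g h hgh
    refine Finset.prod_congr rfl fun i hi => ?_
    have hi' : i ∉ mSet E V' := fun hi' =>
      Set.notMem_empty i (hm ▸ ⟨(Finset.mem_filter.mp hi).2, hi'⟩)
    have hpa : (fun j : {j : V // E j i} => g j.1) = fun j : {j : V // E j i} => h j.1 :=
      funext fun j => hgh j fun hj => hi' (Or.inr ⟨j, hj, j.2⟩)
    rw [hpa, hgh i fun hj => hi' (Or.inl hj)]
  · intro g h hgh
    have hcompl : ∀ j, j ∉ U → g j = h j := fun j hj => hgh j <| by
      have : j ∈ U ∪ V' ∪ Z := hcover ▸ Set.mem_univ j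
      simp only [Set.mem_union] at this ⊢
      tauto
    refine Finset.prod_congr rfl fun i hi => ?_
    have hi' := (Finset.mem_filter.mp hi).2
    have hpa : (fun j : {j : V // E j i} => g j.1) = fun j : {j : V // E j i} => h j.1 :=
      funext fun j => hcompl j fun hj => hi' (Or.inr ⟨j, hj, j.2⟩)
    rw [hpa, hcompl i fun hj => hi' (Or.inl hj)]
end
end

section
/- Suppose a probability distribution P on A × B × C admits a classical triangle model. Then there exists a probability distribution P' on A × B × C such that: (1) the marginal of P' on A × C is the product of the marginals of P on A and on C, i.e. P'(a,c) = P(a)·P(c) for all a, c; (2) the marginal of P' on A × B equals that of P, i.e. P'(a,b) = P(a,b); and (3) the marginal of P' on B × C equals that of P, i.e. P'(b,c) = P(b,c). -/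
open scoped Classical

noncomputable section

/-- `P` admits a classical triangle model: there are nonempty finite hidden-variable
sets `ΛAB`, `ΛBC`, `ΛAC` with probability distributions `qAB`, `qBC`, `qAC`, and
stochastic kernels `PA(a | λAB, λAC)`, `PB(b | λAB, λBC)`, `PC(c | λBC, λAC)`, such that
`P(a,b,c) = Σ qAB(λAB)·qBC(λBC)·qAC(λAC)·PA(a|λAB,λAC)·PB(b|λAB,λBC)·PC(c|λBC,λAC)`. -/
def AdmitsTriangleModel {A B C : Type} [Fintype A] [Fintype B] [Fintype C]
    (P : A → B → C → ℝ) : Prop :=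
  ∃ (ΛAB ΛBC ΛAC : Type) (_ : Fintype ΛAB) (_ : Fintype ΛBC) (_ : Fintype ΛAC),
    Nonempty ΛAB ∧ Nonempty ΛBC ∧ Nonempty ΛAC ∧
    ∃ (qAB : ΛAB → ℝ) (qBC : ΛBC → ℝ) (qAC : ΛAC → ℝ)
      (PA : ΛAB → ΛAC → A → ℝ) (PB : ΛAB → ΛBC → B → ℝ) (PC : ΛBC → ΛAC → C → ℝ),
      (∀ l, 0 ≤ qAB l) ∧ (∑ l, qAB l) = 1 ∧
      (∀ l, 0 ≤ qBC l) ∧ (∑ l, qBC l) = 1 ∧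
      (∀ l, 0 ≤ qAC l) ∧ (∑ l, qAC l) = 1 ∧
      (∀ lab lac a, 0 ≤ PA lab lac a) ∧ (∀ lab lac, (∑ a, PA lab lac a) = 1) ∧
      (∀ lab lbc b, 0 ≤ PB lab lbc b) ∧ (∀ lab lbc, (∑ b, PB lab lbc b) = 1) ∧
      (∀ lbc lac c, 0 ≤ PC lbc lac c) ∧ (∀ lbc lac, (∑ c, PC lbc lac c) = 1) ∧
      ∀ a b c, P a b c =
        ∑ lab : ΛAB, ∑ lbc : ΛBC, ∑ lac : ΛAC,
          qAB lab * qBC lbc * qAC lac * PA lab lac a * PB lab lbc b * PC lbc lac c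

/-- Summing out a variable that enters only through a normalized kernel. -/
lemma sum_sum_mul_kernel {X Y Z : Type*} [Fintype X] [Fintype Y] [Fintype Z]
    (f : X → Y → ℝ) (g : X → Y → Z → ℝ) (hg : ∀ x y, ∑ z, g x y z = 1) :
    ∑ z, ∑ x, ∑ y, f x y * g x y z = ∑ x, ∑ y, f x y := by
  rw [Finset.sum_comm]
  refine Finset.sum_congr rfl fun x _ => ?_
  rw [Finset.sum_comm]
  refine Finset.sum_congr rfl fun y _ => ?_
  rw [← Finset.mul_sum, hg, mul_one]

/-- Averaging a normalized kernel over a probability distribution gives a normalized kernel. -/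
lemma sum_average_kernel {Y Z : Type*} [Fintype Y] [Fintype Z]
    (q : Y → ℝ) (k : Y → Z → ℝ) (hq : ∑ y, q y = 1) (hk : ∀ y, ∑ z, k y z = 1) :
    ∑ z, ∑ y, q y * k y z = 1 := by
  rw [Finset.sum_comm]
  simp_rw [← Finset.mul_sum, hk, mul_one, hq]

/-- If a probability distribution `P` on `A × B × C` admits a
classical triangle model, then there is a probability distribution `P'` on `A × B × C`
with `P'(a,c) = P(a)·P(c)`, `P'(a,b) = P(a,b)` and `P'(b,c) = P(b,c)`. -/
theorem stmt5 {A B C : Type} [Fintype A] [Fintype B] [Fintype C]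
    [Nonempty A] [Nonempty B] [Nonempty C]
    (P : A → B → C → ℝ) (hpos : ∀ a b c, 0 ≤ P a b c)
    (hsum : ∑ a, ∑ b, ∑ c, P a b c = 1)
    (h : AdmitsTriangleModel P) :
    ∃ P' : A → B → C → ℝ,
      (∀ a b c, 0 ≤ P' a b c) ∧ (∑ a, ∑ b, ∑ c, P' a b c = 1) ∧
      (∀ a c, (∑ b, P' a b c) = (∑ b, ∑ c', P a b c') * (∑ a', ∑ b, P a' b c)) ∧
      (∀ a b, (∑ c, P' a b c) = ∑ c, P a b c) ∧
      (∀ b c, (∑ a, P' a b c) = ∑ a, P a b c) := by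
  obtain ⟨ΛAB, ΛBC, ΛAC, _, _, _, -, -, -, qAB, qBC, qAC, PA, PB, PC, hqAB, sqAB, hqBC, sqBC,
    hqAC, sqAC, hPA, sPA, hPB, sPB, hPC, sPC, hP⟩ := h
  let α : ΛAB → A → ℝ := fun x a => ∑ z, qAC z * PA x z a
  let γ : ΛBC → C → ℝ := fun y c => ∑ z, qAC z * PC y z c
  have hα : ∀ x a, 0 ≤ α x a := fun x a =>
    Finset.sum_nonneg fun z _ => mul_nonneg (hqAC z) (hPA x z a)
  have hγ : ∀ y c, 0 ≤ γ y c := fun y c =>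
    Finset.sum_nonneg fun z _ => mul_nonneg (hqAC z) (hPC y z c)
  have sα : ∀ x, ∑ a, α x a = 1 := fun x => sum_average_kernel qAC (PA x) sqAC (sPA x)
  have sγ : ∀ y, ∑ c, γ y c = 1 := fun y => sum_average_kernel qAC (PC y) sqAC (sPC y)
  let Q : A → B → C → ℝ := fun a b c =>
    ∑ x, ∑ y, qAB x * qBC y * α x a * PB x y b * γ y c
  have hQab : ∀ a b, ∑ c, Q a b c = ∑ c, P a b c := by
    intro a b
    rw [sum_sum_mul_kernel (fun x y => qAB x * qBC y * α x a * PB x y b) (fun _ y => γ y)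
      fun _ y => sγ y]
    simp_rw [hP]
    symm
    rw [Finset.sum_comm]
    refine Finset.sum_congr rfl fun x _ => ?_
    symm
    rw [sum_sum_mul_kernel (fun y z => qAB x * qBC y * qAC z * PA x z a * PB x y b) PC sPC]
    refine Finset.sum_congr rfl fun y _ => ?_
    simp only [α, Finset.mul_sum, Finset.sum_mul]
    exact Finset.sum_congr rfl fun z _ => by ring
  have hQbc : ∀ b c, ∑ a, Q a b c = ∑ a, P a b c := by
    intro b c
    have h₁ : ∑ a, Q a b c = ∑ x, ∑ y, qAB x * qBC y * PB x y b * γ y c := by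
      rw [← sum_sum_mul_kernel (fun x y => qAB x * qBC y * PB x y b * γ y c) (fun x _ => α x)
        fun x _ => sα x]
      refine Finset.sum_congr rfl fun a _ => Finset.sum_congr rfl fun x _ =>
        Finset.sum_congr rfl fun y _ => by ring
    rw [h₁]
    simp_rw [hP]
    symm
    rw [Finset.sum_comm]
    refine Finset.sum_congr rfl fun x _ => ?_
    symm
    have h₂ := sum_sum_mul_kernel (fun y z => qAB x * qBC y * qAC z * PB x y b * PC y z c)
      (fun _ z => PA x z) fun _ z => sPA x z
    trans ∑ y, ∑ z, qAB x * qBC y * qAC z * PB x y b * PC y z c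
    · refine Finset.sum_congr rfl fun y _ => ?_
      simp only [γ, Finset.mul_sum]
      exact Finset.sum_congr rfl fun z _ => by ring
    · rw [← h₂]
      exact Finset.sum_congr rfl fun a _ => Finset.sum_congr rfl fun y _ =>
        Finset.sum_congr rfl fun z _ => by ring
  have hQac : ∀ a c, ∑ b, Q a b c = (∑ x, qAB x * α x a) * ∑ y, qBC y * γ y c := by
    intro a c
    rw [Finset.sum_mul_sum, ← sum_sum_mul_kernel (fun x y => qAB x * α x a * (qBC y * γ y c)) PB sPB]
    exact Finset.sum_congr rfl fun b _ => Finset.sum_congr rfl fun x _ =>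
      Finset.sum_congr rfl fun y _ => by ring
  have hPa : ∀ a, ∑ b, ∑ c, P a b c = ∑ x, qAB x * α x a := by
    intro a
    simp_rw [← hQab]
    rw [Finset.sum_comm]
    simp_rw [hQac]
    rw [← Finset.mul_sum, sum_average_kernel qBC γ sqBC sγ, mul_one]
  have hPc : ∀ c, ∑ a, ∑ b, P a b c = ∑ y, qBC y * γ y c := by
    intro c
    rw [Finset.sum_comm]
    simp_rw [← hQbc]
    rw [Finset.sum_comm]
    simp_rw [hQac]
    rw [← Finset.sum_mul, sum_average_kernel qAB α sqAB sα, one_mul]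
  refine ⟨Q, fun a b c => ?_, ?_, fun a c => ?_, hQab, hQbc⟩
  · exact Finset.sum_nonneg fun x _ => Finset.sum_nonneg fun y _ =>
      mul_nonneg (mul_nonneg (mul_nonneg (mul_nonneg (hqAB x) (hqBC y)) (hα x a)) (hPB x y b))
        (hγ y c)
  · simp_rw [hQab, hsum]
  · rw [hQac, hPa, hPc]
end
end

section
/- If a probability distribution P on A × B × C admits a classical triangle model, then I(A:B) + I(B:C) ≤ H(B), where the entropies and mutual informations are computed from P and its marginals. -/
open scoped Classical

noncomputable section

/-- The Shannon entropy (natural logarithm) of a distribution `p` on a finite set: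
`H(p) = Σ_{s : p(s) > 0} −p(s)·log p(s)`. -/
noncomputable def shannonH {S : Type} [Fintype S] (p : S → ℝ) : ℝ :=
  ∑ s, if 0 < p s then -(p s * Real.log (p s)) else 0

open Real in
/-- Strong subadditivity of entropy, for nonnegative weights on `X × Y × Z`. -/
theorem sum_negMulLog_submodular {X Y Z : Type*} [Fintype X] [Fintype Y] [Fintype Z]
    (f : X → Y → Z → ℝ) (hf : ∀ x y z, 0 ≤ f x y z) :
    (∑ x, ∑ y, ∑ z, negMulLog (f x y z)) + ∑ z, negMulLog (∑ x, ∑ y, f x y z)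
      ≤ (∑ x, ∑ z, negMulLog (∑ y, f x y z)) + ∑ y, ∑ z, negMulLog (∑ x, f x y z) := by
  set u : X → Z → ℝ := fun x z => ∑ y, f x y z with hu
  set v : Y → Z → ℝ := fun y z => ∑ x, f x y z with hv
  set w : Z → ℝ := fun z => ∑ x, ∑ y, f x y z with hw
  have hfu : ∀ x y z, f x y z ≤ u x z := fun x y z =>
    Finset.single_le_sum (f := fun y => f x y z) (fun _ _ => hf _ _ _) (Finset.mem_univ y)
  have hfv : ∀ x y z, f x y z ≤ v y z := fun x y z =>
    Finset.single_le_sum (f := fun x => f x y z) (fun _ _ => hf _ _ _) (Finset.mem_univ x)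
  have hu0 : ∀ x z, 0 ≤ u x z := fun x z => Finset.sum_nonneg fun _ _ => hf _ _ _
  have hv0 : ∀ y z, 0 ≤ v y z := fun y z => Finset.sum_nonneg fun _ _ => hf _ _ _
  have hw0 : ∀ z, 0 ≤ w z := fun z => Finset.sum_nonneg fun x _ => hu0 x z
  have huw : ∀ x z, u x z ≤ w z := fun x z =>
    Finset.single_le_sum (f := fun x => u x z) (fun x _ => hu0 x z) (Finset.mem_univ x)
  have hsumv : ∀ z, ∑ y, v y z = w z := fun z => Finset.sum_comm
  have pointwise : ∀ x y z, f x y z * (log (u x z) + log (v y z) - log (f x y z) - log (w z))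
      ≤ u x z * v y z / w z - f x y z := by
    intro x y z
    rcases (hf x y z).eq_or_lt with h | h
    · rw [← h]
      have := div_nonneg (mul_nonneg (hu0 x z) (hv0 y z)) (hw0 z)
      simpa using this
    · have h1 := h.trans_le (hfu x y z)
      have h2 := h.trans_le (hfv x y z)
      have h3 := h1.trans_le (huw x z)
      have key := log_le_sub_one_of_pos (x := u x z * v y z / (f x y z * w z)) (by positivity)
      rw [log_div (by positivity) (by positivity), log_mul h1.ne' h2.ne',
        log_mul h.ne' h3.ne'] at key
      calc _ = f x y z * (log (u x z) + log (v y z) - (log (f x y z) + log (w z))) := by ring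
        _ ≤ f x y z * (u x z * v y z / (f x y z * w z) - 1) :=
          mul_le_mul_of_nonneg_left key h.le
        _ = _ := by field_simp
  have total : ∑ x, ∑ y, ∑ z, (u x z * v y z / w z - f x y z) = 0 := by
    calc _ = ∑ z, ∑ x, ∑ y, (u x z * v y z / w z - f x y z) := by
          rw [Finset.sum_congr rfl fun x _ => Finset.sum_comm, Finset.sum_comm]
      _ = ∑ z, (w z * w z / w z - w z) := by
          refine Finset.sum_congr rfl fun z _ => ?_
          simp only [Finset.sum_sub_distrib, ← Finset.sum_div, ← Finset.mul_sum,
            ← Finset.sum_mul, hsumv]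
          rfl
      _ = 0 := by simp
  have swap : ∀ g : X → Y → Z → ℝ, ∑ x, ∑ y, ∑ z, g x y z = ∑ x, ∑ z, ∑ y, g x y z :=
    fun g => Finset.sum_congr rfl fun x _ => Finset.sum_comm
  have eu : ∑ x, ∑ z, negMulLog (u x z) = -∑ x, ∑ y, ∑ z, f x y z * log (u x z) := by
    rw [swap]
    simp only [negMulLog, neg_mul, Finset.sum_neg_distrib, ← Finset.sum_mul, hu]
  have ev : ∑ y, ∑ z, negMulLog (v y z) = -∑ x, ∑ y, ∑ z, f x y z * log (v y z) := by
    rw [Finset.sum_comm (s := (Finset.univ : Finset X)),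
      Finset.sum_congr rfl fun y _ => Finset.sum_comm]
    simp only [negMulLog, neg_mul, Finset.sum_neg_distrib, ← Finset.sum_mul, hv]
  have ew : ∑ z, negMulLog (w z) = -∑ x, ∑ y, ∑ z, f x y z * log (w z) := by
    rw [swap, Finset.sum_comm]
    simp only [negMulLog, neg_mul, Finset.sum_neg_distrib, ← Finset.sum_mul, hw]
  have ef : ∑ x, ∑ y, ∑ z, negMulLog (f x y z)
      = -∑ x, ∑ y, ∑ z, f x y z * log (f x y z) := by
    simp only [negMulLog, neg_mul, Finset.sum_neg_distrib]
  have main := Finset.sum_le_sum fun x (_ : x ∈ Finset.univ) =>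
    Finset.sum_le_sum fun y (_ : y ∈ Finset.univ) =>
      Finset.sum_le_sum fun z (_ : z ∈ Finset.univ) => pointwise x y z
  rw [total] at main
  simp only [mul_sub, mul_add, Finset.sum_sub_distrib, Finset.sum_add_distrib] at main
  rw [eu, ev, ew, ef]
  linarith

open Real in
theorem sum_negMulLog_mul_of_sum_eq_one {A : Type*} [Fintype A] (t : ℝ) {k : A → ℝ}
    (hk : ∑ a, k a = 1) :
    ∑ a, negMulLog (t * k a) = negMulLog t + t * ∑ a, negMulLog (k a) := by
  simp only [negMulLog_mul, Finset.sum_add_distrib, ← Finset.sum_mul, ← Finset.mul_sum, hk, one_mul]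

open Real in
/-- Data processing: if `A` and `B` are conditionally independent given `X`, then
`I(A:B) ≤ I(X:B)`; the entropy of `B` is cancelled from both sides. -/
theorem sum_negMulLog_data_processing {X A B : Type*} [Fintype X] [Fintype A] [Fintype B]
    {q : X → ℝ} {α : X → A → ℝ} {β : X → B → ℝ} (hq : ∀ x, 0 ≤ q x)
    (hα : ∀ x a, 0 ≤ α x a) (hα1 : ∀ x, ∑ a, α x a = 1)
    (hβ : ∀ x b, 0 ≤ β x b) (hβ1 : ∀ x, ∑ b, β x b = 1) :
    (∑ a, negMulLog (∑ x, q x * α x a)) + ∑ x, ∑ b, negMulLog (q x * β x b)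
      ≤ (∑ x, negMulLog (q x)) + ∑ b, ∑ a, negMulLog (∑ x, q x * α x a * β x b) := by
  have ssa := sum_negMulLog_submodular (fun x b a => q x * α x a * β x b)
    fun x b a => mul_nonneg (mul_nonneg (hq x) (hα x a)) (hβ x b)
  simp only [← Finset.mul_sum, hβ1, mul_one] at ssa
  have joint : ∀ x, ∑ b, ∑ a, negMulLog (q x * α x a * β x b)
      = (∑ a, negMulLog (q x * α x a)) + ∑ b, negMulLog (q x * β x b) - negMulLog (q x) := by
    intro x
    rw [Finset.sum_comm]
    simp only [sum_negMulLog_mul_of_sum_eq_one _ (hβ1 x), sum_negMulLog_mul_of_sum_eq_one _ (hα1 x),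
      Finset.sum_add_distrib, ← Finset.sum_mul, ← Finset.mul_sum, hα1]
    ring
  simp only [joint, Finset.sum_add_distrib, Finset.sum_sub_distrib] at ssa
  linarith

open Real in
/-- If `X` and `Y` are independent, then `I(X:B) + I(Y:B) ≤ H(B)`. -/
theorem sum_negMulLog_independent_sources {X Y B : Type*} [Fintype X] [Fintype Y] [Fintype B]
    {p : X → ℝ} {q : Y → ℝ} {k : X → Y → B → ℝ} (hp : ∀ x, 0 ≤ p x) (hp1 : ∑ x, p x = 1)
    (hq : ∀ y, 0 ≤ q y) (hq1 : ∑ y, q y = 1)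
    (hk : ∀ x y b, 0 ≤ k x y b) (hk1 : ∀ x y, ∑ b, k x y b = 1) :
    (∑ x, negMulLog (p x)) + (∑ y, negMulLog (q y))
        + ∑ b, negMulLog (∑ x, ∑ y, p x * q y * k x y b)
      ≤ (∑ x, ∑ b, negMulLog (∑ y, p x * q y * k x y b))
        + ∑ y, ∑ b, negMulLog (∑ x, p x * q y * k x y b) := by
  have ssa := sum_negMulLog_submodular (fun x y b => p x * q y * k x y b)
    fun x y b => mul_nonneg (mul_nonneg (hp x) (hq y)) (hk x y b)
  have hind : ∑ x, ∑ y, negMulLog (p x * q y)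
      = (∑ x, negMulLog (p x)) + ∑ y, negMulLog (q y) := by
    simp only [sum_negMulLog_mul_of_sum_eq_one _ hq1, Finset.sum_add_distrib, ← Finset.sum_mul,
      hp1, one_mul]
  have hle : ∑ x, ∑ y, negMulLog (p x * q y)
      ≤ ∑ x, ∑ y, ∑ b, negMulLog (p x * q y * k x y b) := by
    refine Finset.sum_le_sum fun x _ => Finset.sum_le_sum fun y _ => ?_
    rw [sum_negMulLog_mul_of_sum_eq_one _ (hk1 x y)]
    refine le_add_of_nonneg_right (mul_nonneg (mul_nonneg (hp x) (hq y)) ?_)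
    refine Finset.sum_nonneg fun b _ => negMulLog_nonneg (hk x y b) ?_
    rw [← hk1 x y]
    exact Finset.single_le_sum (fun b _ => hk x y b) (Finset.mem_univ b)
  linarith

theorem shannonH_eq_sum_negMulLog {S : Type} [Fintype S] {p : S → ℝ} (hp : ∀ s, 0 ≤ p s) :
    shannonH p = ∑ s, Real.negMulLog (p s) := by
  refine Finset.sum_congr rfl fun s _ => ?_
  rcases (hp s).eq_or_lt with h | h
  · simp [← h]
  · simp [h, Real.negMulLog]

/-- If a probability distribution `P` on `A × B × C` admits a
classical triangle model, then `I(A:B) + I(B:C) ≤ H(B)`, where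
`I(X:Y) = H(X) + H(Y) − H(X,Y)` and all entropies are computed from `P` and its
marginals. -/
theorem stmt7 {A B C : Type} [Fintype A] [Fintype B] [Fintype C]
    [Nonempty A] [Nonempty B] [Nonempty C]
    (P : A → B → C → ℝ) (hpos : ∀ a b c, 0 ≤ P a b c)
    (hsum : ∑ a, ∑ b, ∑ c, P a b c = 1)
    (h : AdmitsTriangleModel P) :
    (shannonH (fun a => ∑ b, ∑ c, P a b c) + shannonH (fun b => ∑ a, ∑ c, P a b c)
        - shannonH (fun p : A × B => ∑ c, P p.1 p.2 c))
      + (shannonH (fun b => ∑ a, ∑ c, P a b c) + shannonH (fun c => ∑ a, ∑ b, P a b c)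
        - shannonH (fun p : B × C => ∑ a, P a p.1 p.2))
      ≤ shannonH (fun b => ∑ a, ∑ c, P a b c) := by
  obtain ⟨X, Y, Z, _, _, _, -, -, -, p, q, r, PA, PB, PC, hp, hp1, hq, hq1, hr, hr1,
    hA, hA1, hB, hB1, hC, hC1, hP⟩ := h
  rw [shannonH_eq_sum_negMulLog fun a => Finset.sum_nonneg fun b _ =>
      Finset.sum_nonneg fun c _ => hpos a b c,
    shannonH_eq_sum_negMulLog fun b => Finset.sum_nonneg fun a _ =>
      Finset.sum_nonneg fun c _ => hpos a b c,
    shannonH_eq_sum_negMulLog fun c => Finset.sum_nonneg fun a _ =>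
      Finset.sum_nonneg fun b _ => hpos a b c,
    shannonH_eq_sum_negMulLog fun s : A × B => Finset.sum_nonneg fun c _ => hpos s.1 s.2 c,
    shannonH_eq_sum_negMulLog fun s : B × C => Finset.sum_nonneg fun a _ => hpos a s.1 s.2,
    Fintype.sum_prod_type, Fintype.sum_prod_type]
  set α : X → A → ℝ := fun x a => ∑ z, r z * PA x z a with hα
  set γ : Y → C → ℝ := fun y c => ∑ z, r z * PC y z c with hγ
  set β₁ : X → B → ℝ := fun x b => ∑ y, q y * PB x y b with hβ₁
  set β₂ : Y → B → ℝ := fun y b => ∑ x, p x * PB x y b with hβ₂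
  have mix : ∀ {I J : Type} [Fintype I] [Fintype J] (w : I → ℝ) (k : I → J → ℝ),
      ∑ i, w i = 1 → (∀ i, ∑ j, k i j = 1) → ∑ j, ∑ i, w i * k i j = 1 := by
    intro I J _ _ w k hw hk
    rw [Finset.sum_comm]
    simp only [← Finset.mul_sum, hk, mul_one, hw]
  have hα1 : ∀ x, ∑ a, α x a = 1 := fun x => mix _ _ hr1 (hA1 x)
  have hγ1 : ∀ y, ∑ c, γ y c = 1 := fun y => mix _ _ hr1 (hC1 y)
  have hβ₁1 : ∀ x, ∑ b, β₁ x b = 1 := fun x => mix _ _ hq1 (hB1 x)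
  have hβ₂1 : ∀ y, ∑ b, β₂ y b = 1 := fun y => mix _ _ hp1 fun x => hB1 x y
  have hAB : ∀ a b, ∑ c, P a b c = ∑ x, p x * α x a * β₁ x b := by
    intro a b
    simp only [hP]
    rw [Finset.sum_comm]
    refine Finset.sum_congr rfl fun x _ => ?_
    rw [Finset.sum_comm, hβ₁, Finset.mul_sum]
    refine Finset.sum_congr rfl fun y _ => ?_
    rw [Finset.sum_comm, hα]
    simp only [← Finset.mul_sum, hC1, mul_one]
    rw [Finset.mul_sum, Finset.sum_mul]
    exact Finset.sum_congr rfl fun z _ => by ring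
  have hBC : ∀ b c, ∑ a, P a b c = ∑ y, q y * γ y c * β₂ y b := by
    intro b c
    simp only [hP]
    rw [Finset.sum_comm, Finset.sum_congr rfl fun x _ => Finset.sum_comm, Finset.sum_comm]
    refine Finset.sum_congr rfl fun y _ => ?_
    rw [hβ₂, Finset.mul_sum]
    refine Finset.sum_congr rfl fun x _ => ?_
    rw [Finset.sum_comm, hγ, Finset.mul_sum, Finset.sum_mul]
    refine Finset.sum_congr rfl fun z _ => ?_
    simp only [← Finset.mul_sum, ← Finset.sum_mul, hA1, mul_one]
    ring
  have hPA : ∀ a, ∑ b, ∑ c, P a b c = ∑ x, p x * α x a := by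
    intro a
    simp only [hAB]
    rw [Finset.sum_comm]
    simp only [← Finset.mul_sum, hβ₁1, mul_one]
  have hPC : ∀ c, ∑ a, ∑ b, P a b c = ∑ y, q y * γ y c := by
    intro c
    rw [Finset.sum_comm]
    simp only [hBC]
    rw [Finset.sum_comm]
    simp only [← Finset.mul_sum, hβ₂1, mul_one]
  have hPB : ∀ b, ∑ a, ∑ c, P a b c = ∑ x, p x * β₁ x b := by
    intro b
    simp only [hAB]
    rw [Finset.sum_comm]
    simp only [← Finset.mul_sum, ← Finset.sum_mul, hα1, mul_one]
  have hα0 : ∀ x a, 0 ≤ α x a := fun x a =>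
    Finset.sum_nonneg fun z _ => mul_nonneg (hr z) (hA x z a)
  have hγ0 : ∀ y c, 0 ≤ γ y c := fun y c =>
    Finset.sum_nonneg fun z _ => mul_nonneg (hr z) (hC y z c)
  have hβ₁0 : ∀ x b, 0 ≤ β₁ x b := fun x b =>
    Finset.sum_nonneg fun y _ => mul_nonneg (hq y) (hB x y b)
  have hβ₂0 : ∀ y b, 0 ≤ β₂ y b := fun y b =>
    Finset.sum_nonneg fun x _ => mul_nonneg (hp x) (hB x y b)
  have dA := sum_negMulLog_data_processing hp hα0 hα1 hβ₁0 hβ₁1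
  have dC := sum_negMulLog_data_processing hq hγ0 hγ1 hβ₂0 hβ₂1
  have ind := sum_negMulLog_independent_sources hp hp1 hq hq1 hB hB1
  have e₁ : ∀ x b, ∑ y, p x * q y * PB x y b = p x * β₁ x b := fun x b => by
    simp only [hβ₁, Finset.mul_sum, mul_assoc]
  have e₂ : ∀ y b, ∑ x, p x * q y * PB x y b = q y * β₂ y b := fun y b => by
    simp only [hβ₂, Finset.mul_sum]
    exact Finset.sum_congr rfl fun x _ => by ring
  simp only [e₁, e₂] at ind
  rw [Finset.sum_comm (s := (Finset.univ : Finset B))] at dA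
  simp only [hPA, hPB, hPC]
  simp only [hAB, hBC]
  linarith
end
end

section
/- Let A, B, Y, U be nonempty finite sets, q a probability distribution on U, and let P_B(b | y, u) and P_A(a | b, u) be stochastic kernels (probability distributions over b, respectively a, for every value of the conditioning arguments). Define P(a, b | y) = Σ_u q(u) · P_B(b | y, u) · P_A(a | b, u). Then for every b ∈ B: Σ_{a ∈ A} max_{y ∈ Y} P(a, b | y) ≤ 1 (the instrumental inequality). -/
open scoped Classical

noncomputable section

/-- instrumental inequality, classical case.  Let `q` be a
probability distribution on `U`, and `PB(b | y, u)`, `PA(a | b, u)` stochastic kernels.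
With `P(a, b | y) = Σ_u q(u)·PB(b | y, u)·PA(a | b, u)`, for every `b` we have
`Σ_a max_y P(a, b | y) ≤ 1`. -/
theorem stmt9 {A B Y U : Type} [Fintype A] [Fintype B] [Fintype Y] [Fintype U]
    [Nonempty A] [Nonempty B] [Nonempty Y] [Nonempty U]
    (q : U → ℝ) (hq0 : ∀ u, 0 ≤ q u) (hq1 : ∑ u, q u = 1)
    (PB : Y → U → B → ℝ) (hPB0 : ∀ y u b, 0 ≤ PB y u b)
    (hPB1 : ∀ y u, ∑ b, PB y u b = 1)
    (PA : B → U → A → ℝ) (hPA0 : ∀ b u a, 0 ≤ PA b u a)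
    (hPA1 : ∀ b u, ∑ a, PA b u a = 1)
    (b : B) :
    ∑ a, Finset.univ.sup' Finset.univ_nonempty
        (fun y => ∑ u, q u * PB y u b * PA b u a) ≤ 1 := by
  have PB_le_one : ∀ y u, PB y u b ≤ 1 := fun y u =>
    hPB1 y u ▸ Finset.single_le_sum (fun b' _ => hPB0 y u b') (Finset.mem_univ b)
  calc
    _ ≤ ∑ a, ∑ u, q u * PA b u a := by
      refine Finset.sum_le_sum fun a _ => Finset.sup'_le _ _ fun y _ =>
        Finset.sum_le_sum fun u _ => ?_
      exact mul_le_mul_of_nonneg_right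
        (mul_le_of_le_one_right (hq0 u) (PB_le_one y u)) (hPA0 b u a)
    _ = 1 := by
      rw [Finset.sum_comm]
      simp only [← Finset.mul_sum, hPA1, mul_one, hq1]
end
end

section
/- Let A, B, Y be nonempty finite sets and let P'(a, b | x, y), with inputs x ∈ B and y ∈ Y, be a family of probability distributions on A × B (so P'(a,b|x,y) ≥ 0 and Σ_{a,b} P'(a,b|x,y) = 1 for all x, y) satisfying the no-signalling conditions: Σ_b P'(a, b | x, y) is independent of y, and Σ_a P'(a, b | x, y) is independent of x. Define P(a, b | y) = P'(a, b | x = b, y). Then for every b ∈ B: Σ_{a ∈ A} max_{y ∈ Y} P(a, b | y) ≤ 1 (the instrumental inequality holds for all no-signalling boxes). -/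
open scoped Classical

noncomputable section

/-- instrumental inequality for no-signalling boxes.  Let
`P'(a, b | x, y)` (with `x` ranging over `B`) be a family of probability distributions
on `A × B` satisfying the no-signalling conditions.  With `P(a, b | y) = P'(a, b | x = b, y)`,
for every `b` we have `Σ_a max_y P(a, b | y) ≤ 1`. -/
theorem stmt10 {A B Y : Type} [Fintype A] [Fintype B] [Fintype Y]
    [Nonempty A] [Nonempty B] [Nonempty Y]
    (P' : B → Y → A → B → ℝ)
    (hpos : ∀ x y a b, 0 ≤ P' x y a b)
    (hnorm : ∀ x y, ∑ a, ∑ b, P' x y a b = 1)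
    (hnsA : ∀ x y y' a, ∑ b, P' x y a b = ∑ b, P' x y' a b)
    (hnsB : ∀ x x' y b, ∑ a, P' x y a b = ∑ a, P' x' y a b)
    (b : B) :
    ∑ a, Finset.univ.sup' Finset.univ_nonempty (fun y => P' b y a b) ≤ 1 := by
  obtain ⟨y₀⟩ := ‹Nonempty Y›
  rw [← hnorm b y₀]
  refine Finset.sum_le_sum fun a _ => Finset.sup'_le _ _ fun y _ => ?_
  rw [hnsA b y₀ y a]
  exact Finset.single_le_sum (fun b' _ => hpos b y a b') (Finset.mem_univ b)
end
end

section
/- Let G be a GDAG and let X, Y be nodes such that there is a directed path X = P_0 → P_1 → ... → P_k = Y in G with k ≥ 1 in which every intermediate node P_1, ..., P_{k−1} is unobserved. Let H be the GDAG obtained from G by adding the directed edge X → Y (same node set and same observed/unobserved partition; H is again acyclic). Then the classical correlation set of H is contained in that of G: C_H ⊆ C_G. -/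
open scoped Classical

noncomputable section

/-- Membership of `P` in the classical correlation set `C_G` of the GDAG with edge
relation `E` and observed nodes `O` (carrying value sets `Ωo`): there exist nonempty
finite value sets for all nodes (agreeing, up to bijection, with the given value sets on
the observed nodes) and a joint probability distribution over all nodes that is Markov
relative to the GDAG and whose marginal on the observed nodes equals `P`. -/
def MemClassical {V : Type} [Fintype V] [DecidableEq V] (E : V → V → Prop) (O : Set V)
    (Ωo : ↥O → Type) [∀ i, Fintype (Ωo i)] [∀ i, Nonempty (Ωo i)]
    (P : (∀ i : O, Ωo i) → ℝ) : Prop :=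
  ∃ (Ω : V → Type) (_ : ∀ i, Fintype (Ω i)) (_ : ∀ i, Nonempty (Ω i))
    (e : ∀ i : O, Ω i ≃ Ωo i) (Q : (∀ i, Ω i) → ℝ),
    (∀ g, 0 ≤ Q g) ∧ (∑ g, Q g) = 1 ∧ IsMarkov E Ω Q ∧
    ∀ x : ∀ i : O, Ωo i,
      P x = ∑ g : ∀ i, Ω i, if ∀ i : O, e i (g i) = x i then Q g else 0

/-- Adding edges can only enlarge the classical correlation set. -/
theorem MemClassical.mono {V : Type} [Fintype V] [DecidableEq V] {E F : V → V → Prop}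
    (hEF : ∀ u v, E u v → F u v) {O : Set V} {Ωo : ↥O → Type} [∀ i, Fintype (Ωo i)]
    [∀ i, Nonempty (Ωo i)] {P : (∀ i : O, Ωo i) → ℝ} (h : MemClassical E O Ωo P) :
    MemClassical F O Ωo P := by
  obtain ⟨Ω, hf, hn, e, Q, hQ0, hQ1, ⟨κ, hκ0, hκ1, hκ⟩, hP⟩ := h
  exact ⟨Ω, hf, hn, e, Q, hQ0, hQ1,
    ⟨fun i pa => κ i fun j => pa ⟨j.1, hEF _ _ j.2⟩, fun i pa => hκ0 i _, fun i pa => hκ1 i _, hκ⟩,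
    hP⟩

/-- If `X → Z → Y` with `Z` unobserved, the edge `X → Y` does not enlarge the classical
correlation set: `Z` can carry a copy of the value of `X`. -/
theorem MemClassical.of_add_edge {V : Type} [Fintype V] [DecidableEq V] {E : V → V → Prop}
    {O : Set V} {Ωo : ↥O → Type} [∀ i, Fintype (Ωo i)] [∀ i, Nonempty (Ωo i)]
    {P : (∀ i : O, Ωo i) → ℝ} {X Y Z : V} (hXZ : E X Z) (hZY : E Z Y) (hZO : Z ∉ O)
    (h : MemClassical (fun u v => E u v ∨ (u = X ∧ v = Y)) O Ωo P) :
    MemClassical E O Ωo P := by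
  obtain ⟨Ω, hf, hn, e, Q, hQ0, hQ1, ⟨κ, hκ0, hκ1, hκ⟩, hP⟩ := h
  let Ω' : V → Type := fun v => Ω v × (v = Z → Ω X)
  let extend : ∀ v, (∀ j : {j : V // E j v}, Ω' j) →
      ∀ j : {j : V // E j v ∨ (j = X ∧ v = Y)}, Ω j := fun v pa j =>
    if hj : E j.1 v then (pa ⟨j.1, hj⟩).1 else
      have hj' := j.2.resolve_left hj
      cast (congrArg Ω hj'.1.symm) ((pa ⟨Z, hj'.2 ▸ hZY⟩).2 rfl)
  let copy : ∀ v, (∀ j : {j : V // E j v}, Ω' j) → v = Z → Ω X := fun v pa hv =>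
    (pa ⟨X, hv ▸ hXZ⟩).1
  let κ' : ∀ v, (∀ j : {j : V // E j v}, Ω' j) → Ω' v → ℝ := fun v pa x =>
    κ v (extend v pa) x.1 * if x.2 = copy v pa then 1 else 0
  let Q' : (∀ v, Ω' v) → ℝ := fun g => ∏ v, κ' v (fun j => g j.1) (g v)
  have hQ' : ∀ g, Q' g = if (fun v => (g v).2) = (fun v _ => (g X).1)
      then Q (fun v => (g v).1) else 0 := by
    intro g
    split_ifs with hg
    · have hg' : ∀ v, (g v).2 = fun _ => (g X).1 := fun v => congrFun hg v
      simp only [Q', κ', copy, hg', if_true, mul_one, hκ]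
      refine Finset.prod_congr rfl fun v _ => ?_
      congr 1
      funext ⟨j, hj⟩
      simp only [extend]
      split_ifs with h1
      · rfl
      · obtain ⟨rfl, -⟩ := hj.resolve_left h1
        simp [hg']
    · obtain ⟨v, hv⟩ := Function.ne_iff.mp hg
      exact Finset.prod_eq_zero (Finset.mem_univ v) (by simp only [κ', copy, if_neg hv, mul_zero])
  have hsum : ∀ f : (∀ v, Ω v) → ℝ,
      ∑ g : ∀ v, Ω' v, (f fun v => (g v).1) * Q' g = ∑ g, f g * Q g := by
    intro f
    rw [Fintype.sum_equiv (Equiv.arrowProdEquivProdArrow V Ω fun v => (v = Z → Ω X)) _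
      (fun q => f q.1 * if q.2 = (fun v _ => q.1 X) then Q q.1 else 0)
      (fun g => by rw [hQ']; rfl), Fintype.sum_prod_type]
    simp
  have hκ'0 : ∀ v pa x, 0 ≤ κ' v pa x := fun v pa x =>
    mul_nonneg (hκ0 _ _ _) (by split_ifs <;> norm_num)
  refine ⟨Ω', inferInstance, inferInstance, fun i => ?_, Q', ?_, ?_, ⟨κ', hκ'0, ?_, fun g => rfl⟩, ?_⟩
  · haveI : IsEmpty (i.1 = Z) := ⟨fun h => hZO (h ▸ i.2)⟩
    exact { toFun := fun x => e i x.1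
            invFun := fun y => ((e i).symm y, fun h => (hZO (h ▸ i.2)).elim)
            left_inv := fun x => Prod.ext (by simp) (funext fun h => (hZO (h ▸ i.2)).elim)
            right_inv := fun y => by simp }
  · exact fun g => Finset.prod_nonneg fun v _ => hκ'0 v (fun j => g j.1) (g v)
  · simpa [hQ1] using hsum fun _ => 1
  · intro v pa
    simp only [κ', Ω']
    rw [Fintype.sum_prod_type]
    simp [hκ1]
  · intro x
    rw [hP]
    simpa using (hsum fun g => if ∀ i : O, e i (g i) = x i then 1 else 0).symm

/-- Suppose there is a directed path `X = P₀ → P₁ → ⋯ → P_k = Y`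
(`k ≥ 1`) in the GDAG `G` in which every intermediate node is unobserved, and let `H` be
obtained from `G` by adding the directed edge `X → Y`.  Then the classical correlation
set of `H` is contained in that of `G`. -/
theorem stmt13 {V : Type} [Fintype V] [DecidableEq V] (E : V → V → Prop)
    (hE : IsAcyclic E)
    (O : Set V) (Ωo : ↥O → Type) [∀ i, Fintype (Ωo i)] [∀ i, Nonempty (Ωo i)]
    (X Y : V) (k : ℕ) (hk : 1 ≤ k) (p : Fin (k + 1) → V)
    (hp0 : p 0 = X) (hpk : p (Fin.last k) = Y)
    (hchain : ∀ i : Fin k, E (p i.castSucc) (p i.succ))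
    (hmid : ∀ i : Fin (k + 1), i ≠ 0 → i ≠ Fin.last k → p i ∉ O)
    (hH : IsAcyclic (fun u v => E u v ∨ (u = X ∧ v = Y)))
    (P : (∀ i : O, Ωo i) → ℝ)
    (h : MemClassical (fun u v => E u v ∨ (u = X ∧ v = Y)) O Ωo P) :
    MemClassical E O Ωo P := by
  have key : ∀ i : Fin (k + 1), i ≠ 0 →
      MemClassical (fun u v => E u v ∨ (u = X ∧ v = p i)) O Ωo P → MemClassical E O Ωo P := by
    intro i
    induction i using Fin.induction with
    | zero => exact fun h0 => (h0 rfl).elim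
    | succ i ih =>
      intro _ hmem
      by_cases hi : i.castSucc = 0
      · refine hmem.mono ?_
        rintro u v (huv | ⟨rfl, rfl⟩)
        · exact huv
        · simpa [hi, hp0] using hchain i
      · refine ih hi (MemClassical.of_add_edge (X := X) (Y := p i.succ) (Z := p i.castSucc)
          (Or.inr ⟨rfl, rfl⟩) (Or.inl (hchain i)) (hmid _ hi i.castSucc_ne_last) (hmem.mono ?_))
        rintro u v (huv | huv)
        · exact Or.inl (Or.inl huv)
        · exact Or.inr huv
  refine key (Fin.last k) ?_ (hpk ▸ h)
  exact fun h0 => by simp [Fin.ext_iff] at h0; omega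
end
end

section
/- Let G be a GDAG and let X, Y be distinct nodes such that pa(X) ⊆ pa(Y) in G, at least one parent of X is an unobserved node, and there is no directed path from Y to X in G. Let H be the GDAG obtained from G by adding the directed edge X → Y (same node set and observed/unobserved partition; H is acyclic by the last hypothesis). Then the classical correlation set of H is contained in that of G: C_H ⊆ C_G. -/
open scoped Classical

noncomputable section

/-- Kernels that are given as functions of the whole assignment, but depend only on the
parents' values, define a Markov joint distribution. -/
lemma IsMarkov.of_dependsOn_parents {V : Type} [Fintype V] {E : V → V → Prop} {Ω : V → Type}
    [∀ i, Fintype (Ω i)] [∀ i, Nonempty (Ω i)] (K : ∀ i : V, (∀ j, Ω j) → Ω i → ℝ)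
    (hdep : ∀ i g g', (∀ j, E j i → g j = g' j) → K i g = K i g')
    (hnonneg : ∀ i g x, 0 ≤ K i g x) (hsum : ∀ i g, ∑ x, K i g x = 1) :
    IsMarkov E Ω (fun g => ∏ i, K i g (g i)) := by
  refine ⟨fun i pa => K i (fun j => if h : E j i then pa ⟨j, h⟩ else Classical.arbitrary _),
    fun i pa x => hnonneg _ _ _, fun i pa => hsum _ _, fun g => ?_⟩
  refine Finset.prod_congr rfl fun i _ => ?_
  refine congrFun (hdep i _ _ fun j hj => ?_) _
  simp [hj]

/-- The product weight of a function under a stochastic kernel: the response to each input is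
drawn independently. -/
def responseWeight {A B : Type} [Fintype A] (k : A → B → ℝ) (f : A → B) : ℝ :=
  ∏ a, k a (f a)

lemma sum_responseWeight {A B : Type} [Fintype A] [DecidableEq A] [Fintype B] (k : A → B → ℝ)
    (hk : ∀ a, ∑ b, k a b = 1) : ∑ f, responseWeight k f = 1 := by
  unfold responseWeight
  rw [← Fintype.prod_sum]
  simp [hk]

lemma sum_ite_responseWeight {A B : Type} [Fintype A] [DecidableEq A] [Fintype B] [DecidableEq B]
    (k : A → B → ℝ) (hk : ∀ a, ∑ b, k a b = 1) (a : A) (b : B) :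
    ∑ f : A → B, (if b = f a then 1 else 0) * responseWeight k f = k a b := by
  have hterm : ∀ f : A → B, (if b = f a then 1 else 0) * responseWeight k f
      = ∏ c, (if c = a then (if b = f c then 1 else 0) else 1) * k c (f c) := by
    intro f
    rw [Finset.prod_mul_distrib, Fintype.prod_ite_eq']
    rfl
  simp_rw [hterm]
  rw [← Fintype.prod_sum (fun c d => (if c = a then (if b = d then (1 : ℝ) else 0) else 1) * k c d),
    Fintype.prod_eq_single a]
  · simp
  · intro c hc
    simp [hc, hk]

/-- Attaching an extra component of type `R` to the value set at the single node `u`. -/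
def attachEquiv {V : Type} (Ω : V → Type) (u : V) (R : Type) :
    (∀ v, Ω v × (v = u → R)) ≃ (∀ v, Ω v) × R where
  toFun g := (fun v => (g v).1, (g u).2 rfl)
  invFun p v := (p.1 v, fun _ => p.2)
  left_inv g := by
    funext v
    refine Prod.ext rfl ?_
    funext h
    subst h
    rfl
  right_inv _ := rfl

/-- A weight on `R`, transported to the component attached at the node `u`. -/
def attachedWeight {V R : Type} (u : V) (r : R → ℝ) (i : V) (a : i = u → R) : ℝ :=
  if h : i = u then r (a h) else 1

lemma sum_attachedWeight {V R : Type} [Fintype R] (u : V) (r : R → ℝ) (hr : ∑ f, r f = 1)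
    (i : V) [Fintype (i = u → R)] : ∑ a, attachedWeight u r i a = 1 := by
  by_cases h : i = u
  · rw [← hr]
    exact Fintype.sum_equiv ⟨fun a => a h, fun f _ => f, fun _ => rfl, fun _ => rfl⟩ _ _
      fun a => by simp [attachedWeight, h]
  · have : Unique (i = u → R) := ⟨⟨fun h' => absurd h' h⟩, fun a => funext fun h' => absurd h' h⟩
    rw [Fintype.sum_unique]
    simp [attachedWeight, h]

lemma prod_attachedWeight {V R : Type} [Fintype V] (u : V) (r : R → ℝ) (a : ∀ i : V, i = u → R) :
    ∏ i, attachedWeight u r i (a i) = r (a u rfl) := by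
  rw [Fintype.prod_eq_single u]
  · simp [attachedWeight]
  · intro i hi
    simp [attachedWeight, hi]

/-- Membership in the classical correlation set may be witnessed after enlarging the value set of
an unobserved node, provided the enlarged distribution has the original one as its marginal. -/
lemma MemClassical.of_attach {V : Type} [Fintype V] [DecidableEq V] {E : V → V → Prop} {O : Set V}
    {Ωo : ↥O → Type} [∀ i, Fintype (Ωo i)] [∀ i, Nonempty (Ωo i)] {P : (∀ i : O, Ωo i) → ℝ}
    {Ω : V → Type} [∀ i, Fintype (Ω i)] [∀ i, Nonempty (Ω i)] (e : ∀ i : O, Ω i ≃ Ωo i)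
    {Q : (∀ i, Ω i) → ℝ} (hQ : ∑ g, Q g = 1)
    (hP : ∀ x : ∀ i : O, Ωo i, P x = ∑ g : ∀ i, Ω i, if ∀ i : O, e i (g i) = x i then Q g else 0)
    {u : V} (hu : u ∉ O) {R : Type} [Fintype R] [Nonempty R]
    {Q' : (∀ v, Ω v × (v = u → R)) → ℝ} (hnonneg : ∀ g, 0 ≤ Q' g)
    (hM : IsMarkov E (fun v => Ω v × (v = u → R)) Q')
    (hmarg : ∀ g, ∑ f, Q' ((attachEquiv Ω u R).symm (g, f)) = Q g) :
    MemClassical E O Ωo P := by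
  have hsplit : ∀ F : (∀ v, Ω v × (v = u → R)) → ℝ,
      ∑ g, F g = ∑ g, ∑ f, F ((attachEquiv Ω u R).symm (g, f)) := by
    intro F
    rw [← Fintype.sum_prod_type', ← (attachEquiv Ω u R).symm.sum_comp]
  have huniq : ∀ i : O, Nonempty (Unique (((i : V) = u) → R)) := fun i =>
    have hi : (i : V) ≠ u := fun h => hu (h ▸ i.2)
    ⟨⟨fun h => absurd h hi⟩, fun a => funext fun h => absurd h hi⟩
  let e' : ∀ i : O, (Ω i × (((i : V) = u) → R)) ≃ Ωo i := fun i =>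
    have := (huniq i).some
    (Equiv.prodUnique _ _).trans (e i)
  have he' : ∀ i p, e' i p = e i p.1 := fun i p => rfl
  refine ⟨fun v => Ω v × (v = u → R), inferInstance, inferInstance, e', Q', hnonneg, ?_, hM, ?_⟩
  · rw [hsplit, ← hQ]
    exact Finset.sum_congr rfl fun g _ => hmarg g
  · intro x
    rw [hP, hsplit]
    refine Finset.sum_congr rfl fun g _ => ?_
    by_cases hx : ∀ i : O, e i (g i) = x i
    · rw [if_pos hx, ← hmarg]
      refine Finset.sum_congr rfl fun f _ => ?_
      exact (if_pos fun i => (he' i _).trans (hx i)).symm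
    · rw [if_neg hx]
      refine (Finset.sum_eq_zero fun f _ => ?_).symm
      exact if_neg fun h => hx fun i => (he' i _).symm.trans (h i)

/-- Let `X ≠ Y` be nodes of the GDAG `G` with `pa(X) ⊆ pa(Y)`, such
that at least one parent of `X` is unobserved and there is no directed path from `Y` to
`X`, and let `H` be obtained from `G` by adding the directed edge `X → Y`.  Then the
classical correlation set of `H` is contained in that of `G`. -/
theorem stmt14 {V : Type} [Fintype V] [DecidableEq V] (E : V → V → Prop)
    (hE : IsAcyclic E)
    (O : Set V) (Ωo : ↥O → Type) [∀ i, Fintype (Ωo i)] [∀ i, Nonempty (Ωo i)]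
    (X Y : V) (hXY : X ≠ Y)
    (hpa : ∀ u, E u X → E u Y)
    (hunobs : ∃ u, E u X ∧ u ∉ O)
    (hnopath : ¬ Relation.TransGen E Y X)
    (hH : IsAcyclic (fun u v => E u v ∨ (u = X ∧ v = Y)))
    (P : (∀ i : O, Ωo i) → ℝ)
    (h : MemClassical (fun u v => E u v ∨ (u = X ∧ v = Y)) O Ωo P) :
    MemClassical E O Ωo P := by
  obtain ⟨Ω, _, _, e, Q, -, hQ, ⟨k, hk0, hk1, hkQ⟩, hP⟩ := h
  obtain ⟨u, huX, hu⟩ := hunobs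
  let A := ∀ j : {j : V // E j X ∨ (j = X ∧ X = Y)}, Ω j
  let R := A → Ω X
  let K : ∀ i, (∀ j, Ω j) → Ω i → ℝ := fun i g => k i (fun j => g j.1)
  have hKdep : ∀ i g g', (∀ j, (E j i ∨ (j = X ∧ i = Y)) → g j = g' j) → K i g = K i g' :=
    fun i g g' h => congrArg (k i) (funext fun j => h j.1 j.2)
  let r : R → ℝ := responseWeight (k X)
  let val : (∀ v, Ω v × (v = u → R)) → ∀ v, Ω v := fun g v => (g v).1
  let resp : (∀ v, Ω v × (v = u → R)) → Ω X := fun g => (g u).2 rfl (fun j : {j : V // E j X ∨ (j = X ∧ X = Y)} => (g j.1).1)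
  have hresp : ∀ g g', (∀ j, E j X → g j = g' j) → resp g = resp g' := by
    intro g g' h
    have h2 : (fun j : {j : V // E j X ∨ (j = X ∧ X = Y)} => (g j.1).1)
        = fun j : {j : V // E j X ∨ (j = X ∧ X = Y)} => (g' j.1).1 := by
      funext j
      rw [h j.1 (j.2.resolve_right fun hj => hXY hj.2)]
    simp only [resp]
    rw [h2, h u huX]
  let B : ∀ i, (∀ v, Ω v × (v = u → R)) → Ω i → ℝ :=
    Function.update (Function.update (fun i g => K i (val g)) X
      (fun g x => if x = resp g then 1 else 0)) Y
      (fun g => K Y (Function.update (val g) X (resp g)))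
  have hBY : B Y = fun g => K Y (Function.update (val g) X (resp g)) := Function.update_self ..
  have hBX : B X = fun g x => if x = resp g then 1 else 0 := by
    simp only [B]
    rw [Function.update_of_ne hXY, Function.update_self]
  have hB : ∀ i, i ≠ X → i ≠ Y → B i = fun g => K i (val g) := by
    intro i hiX hiY
    simp only [B]
    rw [Function.update_of_ne hiY, Function.update_of_ne hiX]
  have hBcases : ∀ p : (i : V) → ((∀ v, Ω v × (v = u → R)) → Ω i → ℝ) → Prop,
      p X (fun g x => if x = resp g then 1 else 0) →
      p Y (fun g => K Y (Function.update (val g) X (resp g))) →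
      (∀ i, i ≠ X → i ≠ Y → p i (fun g => K i (val g))) → ∀ i, p i (B i) := by
    intro p hX hY hi i
    by_cases h1 : i = X
    · subst h1; rwa [hBX]
    by_cases h2 : i = Y
    · subst h2; rwa [hBY]
    rw [hB i h1 h2]
    exact hi i h1 h2
  have hBdep : ∀ i g g', (∀ j, E j i → g j = g' j) → B i g = B i g' := by
    refine hBcases (fun i b => ∀ g g', (∀ j, E j i → g j = g' j) → b g = b g') ?_ ?_ ?_
    · intro g g' h
      simp only [hresp g g' h]
    · intro g g' h
      refine hKdep _ _ _ fun j hj => ?_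
      rw [hresp g g' fun j hj => h j (hpa j hj)]
      by_cases hjX : j = X
      · subst hjX; simp
      · rw [Function.update_of_ne hjX, Function.update_of_ne hjX]
        exact congrArg Prod.fst (h j (hj.resolve_right fun h => hjX h.1))
    · intro i _ hiY g g' h
      exact hKdep _ _ _ fun j hj =>
        congrArg Prod.fst (h j (hj.resolve_right fun h => hiY h.2))
  have hB0 : ∀ i g x, 0 ≤ B i g x := by
    refine hBcases (fun i b => ∀ g x, 0 ≤ b g x) ?_ (fun g x => hk0 _ _ _)
      (fun i _ _ g x => hk0 _ _ _)
    intro g x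
    positivity
  have hB1 : ∀ i g, ∑ x, B i g x = 1 := by
    refine hBcases (fun i b => ∀ g, ∑ x, b g x = 1) ?_ (fun g => hk1 _ _)
      (fun i _ _ g => hk1 _ _)
    intro g
    simp
  have hr0 : ∀ f, 0 ≤ r f := fun f => Finset.prod_nonneg fun a _ => hk0 _ _ _
  have hs0 : ∀ i a, 0 ≤ attachedWeight u r i a := by
    intro i a
    unfold attachedWeight
    split_ifs
    exacts [hr0 _, zero_le_one]
  let L : ∀ i, (∀ v, Ω v × (v = u → R)) → (Ω i × (i = u → R)) → ℝ :=
    fun i g x => B i g x.1 * attachedWeight u r i x.2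
  have hL0 : ∀ i g x, 0 ≤ L i g x := fun i g x => mul_nonneg (hB0 _ _ _) (hs0 _ _)
  refine MemClassical.of_attach e hQ hP hu (Q' := fun g => ∏ i, L i g (g i))
    (fun g => Finset.prod_nonneg fun i _ => hL0 _ _ _)
    (IsMarkov.of_dependsOn_parents L ?_ hL0 ?_) ?_
  · intro i g g' h
    funext x
    simp only [L, hBdep i g g' h]
  · intro i g
    rw [Fintype.sum_prod_type]
    simp only [L]
    rw [← Finset.sum_mul_sum, hB1,
      sum_attachedWeight u r (sum_responseWeight _ (hk1 X)), one_mul]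
  · intro g
    have hterm : ∀ f : R, ∏ i, L i ((attachEquiv Ω u R).symm (g, f))
          ((attachEquiv Ω u R).symm (g, f) i)
        = ((if g X = f (fun j => g j.1) then 1 else 0) * r f)
          * ∏ i ∈ Finset.univ.erase X, K i g (g i) := by
      intro f
      simp only [L]
      rw [Finset.prod_mul_distrib,
        prod_attachedWeight u r (fun i => ((attachEquiv Ω u R).symm (g, f) i).2),
        ← Finset.mul_prod_erase _ _ (Finset.mem_univ X), hBX]
      change (if g X = f (fun j => g j.1) then (1 : ℝ) else 0) * _ * r f = _
      by_cases hf : g X = f (fun j => g j.1)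
      · have hprod : ∀ i ∈ Finset.univ.erase X,
            B i ((attachEquiv Ω u R).symm (g, f)) ((attachEquiv Ω u R).symm (g, f) i).1
              = K i g (g i) := by
          intro i hi
          by_cases hiY : i = Y
          · subst hiY
            rw [hBY]
            change K i (Function.update g X (f fun j => g j.1)) (g i) = _
            rw [← hf, Function.update_eq_self]
          · rw [hB i (Finset.ne_of_mem_erase hi) hiY]
            rfl
        rw [Finset.prod_congr rfl hprod]
        ring
      · simp [hf]
    simp_rw [hterm]
    rw [← Finset.sum_mul, sum_ite_responseWeight (k X) (hk1 X), hkQ,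
      ← Finset.mul_prod_erase _ _ (Finset.mem_univ X)]
end
end

section
/- Let G be a DAG on a finite node set V with nonempty finite value sets Ω_i, and let P be a joint probability distribution over all nodes that is Markov relative to G. Then there exists a functional causal model on G whose induced distribution equals P: nonempty finite noise sets N_i with probability distributions q_i, and functions f_i : (Π_{j ∈ pa(i)} Ω_j) × N_i → Ω_i, such that the pushforward of the product distribution Π_i q_i under the map sending each noise configuration n to the unique global assignment g(n) determined recursively by g(n)_i = f_i(g(n) restricted to pa(i), n_i) is equal to P. -/
open scoped Classical

noncomputable section

theorem IsAcyclic.wellFounded {V : Type} [Finite V] {E : V → V → Prop} (hE : IsAcyclic E) :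
    WellFounded E := by
  have : Std.Irrefl (Relation.TransGen E) := ⟨hE⟩
  have : IsTrans V (Relation.TransGen E) := ⟨fun _ _ _ => Relation.TransGen.trans⟩
  exact Subrelation.wf Relation.TransGen.single
    (Finite.wellFounded_of_trans_of_irrefl (Relation.TransGen E))

/-- Under a product distribution, the event that each coordinate lies in a prescribed set has
probability the product of the coordinatewise probabilities. -/
theorem sum_ite_forall_prod {ι : Type} [Fintype ι] [DecidableEq ι] {N : ι → Type}
    [∀ i, Fintype (N i)] (q : ∀ i, N i → ℝ) (p : ∀ i, N i → Prop) :
    (∑ n : ∀ i, N i, if ∀ i, p i (n i) then ∏ i, q i (n i) else 0) =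
      ∏ i, ∑ m, if p i m then q i m else 0 := by
  rw [Fintype.prod_sum]
  refine Finset.sum_congr rfl fun n _ => ?_
  rw [Finset.prod_ite_zero]
  simp

/-- The coordinate marginals of a product distribution are its factors. -/
theorem sum_ite_apply_eq_prod {A B : Type} [Fintype A] [DecidableEq A] [Fintype B]
    (k : A → B → ℝ) (hk : ∀ a, ∑ x, k a x = 1) (a : A) (x : B) :
    (∑ m : A → B, if m a = x then ∏ c, k c (m c) else 0) = k a x := by
  have h := sum_ite_forall_prod k fun c y => c = a → y = x
  simp only [forall_eq] at h
  rw [h, Finset.prod_eq_single a]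
  · simp
  · intro c _ hc
    simp [hc, hk]
  · simp

/-- The solution of the structural equations `g i = f i (g restricted to the parents of i)`. -/
def solveRec {V : Type} {E : V → V → Prop} (hE : WellFounded E) {Ω : V → Type}
    (f : ∀ i : V, (∀ j : {j : V // E j i}, Ω j) → Ω i) (i : V) : Ω i :=
  hE.fix (C := Ω) (fun i ih => f i fun j => ih j.1 j.2) i

theorem solveRec_eq {V : Type} {E : V → V → Prop} (hE : WellFounded E) {Ω : V → Type}
    (f : ∀ i : V, (∀ j : {j : V // E j i}, Ω j) → Ω i) (i : V) :
    solveRec hE f i = f i fun j => solveRec hE f j.1 :=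
  hE.fix_eq _ _

theorem solveRec_eq_iff {V : Type} {E : V → V → Prop} (hE : WellFounded E) {Ω : V → Type}
    (f : ∀ i : V, (∀ j : {j : V // E j i}, Ω j) → Ω i) (g : ∀ i, Ω i) :
    solveRec hE f = g ↔ ∀ i, f i (fun j => g j.1) = g i := by
  constructor
  · rintro rfl i
    exact (solveRec_eq hE f i).symm
  · intro h
    funext i
    induction i using hE.induction with
    | _ i ih =>
      rw [solveRec_eq, ← h i]
      congr 1
      funext j
      exact ih j.1 j.2

/-- If the joint probability distribution `P` is Markov relative to
the DAG `G`, then there is a functional causal model on `G` inducing `P`: nonempty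
finite noise sets `N i` with probability distributions `q i`, functions
`f i : (values on pa(i)) × N i → Ω i`, and the (unique, by acyclicity) global assignment
map `gmap` satisfying the recursion `gmap n i = f i (gmap n restricted to pa(i)) (n i)`,
such that the pushforward of the product noise distribution under `gmap` equals `P`. -/
theorem stmt17 {V : Type} [Fintype V] [DecidableEq V] (E : V → V → Prop)
    (hE : IsAcyclic E)
    {Ω : V → Type} [∀ i, Fintype (Ω i)] [∀ i, Nonempty (Ω i)]
    (P : (∀ i, Ω i) → ℝ) (hP : IsProbDist P) (hM : IsMarkov E Ω P) :
    ∃ (N : V → Type) (_ : ∀ i, Fintype (N i)) (_ : ∀ i, Nonempty (N i))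
      (q : ∀ i, N i → ℝ)
      (f : ∀ i : V, (∀ j : {j : V // E j i}, Ω j) → N i → Ω i)
      (gmap : (∀ i, N i) → ∀ i, Ω i),
      (∀ i n, 0 ≤ q i n) ∧ (∀ i, ∑ n, q i n = 1) ∧
      (∀ n i, gmap n i = f i (fun j => gmap n j.1) (n i)) ∧
      (∀ g : ∀ i, Ω i,
        P g = ∑ n : ∀ i, N i, if gmap n = g then ∏ i, q i (n i) else 0) := by
  obtain ⟨k, hk0, hk1, hkP⟩ := hM
  have hwf := hE.wellFounded
  refine ⟨fun i => (∀ j : {j : V // E j i}, Ω j) → Ω i, fun i => inferInstance,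
    fun i => inferInstance, fun i m => ∏ a, k i a (m a), fun i a m => m a,
    fun n => solveRec hwf n, fun i m => Finset.prod_nonneg fun a _ => hk0 i a (m a),
    fun i => ?_, fun n i => solveRec_eq hwf n i, fun g => ?_⟩
  · rw [← Fintype.prod_sum]
    simp [hk1]
  · have h := sum_ite_forall_prod
      (fun i (m : (∀ j : {j : V // E j i}, Ω j) → Ω i) => ∏ a, k i a (m a))
      fun i m => m (fun j => g j.1) = g i
    simp only [solveRec_eq_iff, h, hkP]
    exact Finset.prod_congr rfl fun i _ => (sum_ite_apply_eq_prod (k i) (hk1 i) _ _).symm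
end
end

section
/- Let G be a DAG on a finite node set V with nonempty finite value sets Ω_i, and let a functional causal model on G be given (noise sets N_i with distributions q_i and functions f_i). Then the induced distribution of the functional causal model is Markov relative to G. -/
open scoped Classical

noncomputable section

/-- Solutions of a recursion along an acyclic relation on a finite type are unique. -/
theorem IsAcyclic.eq_of_recursion {V : Type} [Finite V] {E : V → V → Prop}
    (hE : IsAcyclic E) {Ω : V → Type} (F : ∀ i : V, (∀ j : {j : V // E j i}, Ω j) → Ω i)
    {g h : ∀ i, Ω i} (hg : ∀ i, g i = F i (fun j => g j.1))
    (hh : ∀ i, h i = F i (fun j => h j.1)) : g = h := by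
  funext i
  induction i using hE.wellFounded.induction with
  | _ i ih =>
    rw [hg, hh]
    exact congrArg (F i) (funext fun j => ih j.1 j.2)

/-- Given a functional causal model on the DAG `G` — nonempty finite
noise sets `N i` with probability distributions `q i`, functions
`f i : (values on pa(i)) × N i → Ω i`, and the (unique, by acyclicity) global assignment
map `gmap` satisfying the recursion `gmap n i = f i (gmap n restricted to pa(i)) (n i)` —
the induced distribution (the pushforward of the product noise distribution under
`gmap`) is Markov relative to `G`. -/
theorem stmt18 {V : Type} [Fintype V] [DecidableEq V] (E : V → V → Prop)
    (hE : IsAcyclic E)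
    {Ω : V → Type} [∀ i, Fintype (Ω i)] [∀ i, Nonempty (Ω i)]
    (N : V → Type) [∀ i, Fintype (N i)] [∀ i, Nonempty (N i)]
    (q : ∀ i, N i → ℝ) (hq0 : ∀ i n, 0 ≤ q i n) (hq1 : ∀ i, ∑ n, q i n = 1)
    (f : ∀ i : V, (∀ j : {j : V // E j i}, Ω j) → N i → Ω i)
    (gmap : (∀ i, N i) → ∀ i, Ω i)
    (hgmap : ∀ n i, gmap n i = f i (fun j => gmap n j.1) (n i)) :
    IsMarkov E Ω
      (fun g => ∑ n : ∀ i, N i, if gmap n = g then ∏ i, q i (n i) else 0) := by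
  refine ⟨fun i pa x => ∑ m, if f i pa m = x then q i m else 0, ?_, ?_, ?_⟩
  · intro i pa x
    exact Finset.sum_nonneg fun m _ => by split_ifs <;> simp [hq0]
  · intro i pa
    rw [Finset.sum_comm]
    simp [hq1]
  · intro g
    rw [Finset.prod_univ_sum, Fintype.piFinset_univ]
    refine Finset.sum_congr rfl fun n _ => ?_
    have key : gmap n = g ↔ ∀ i, f i (fun j => g j.1) (n i) = g i := by
      refine ⟨fun h i => by rw [← h, ← hgmap], fun h => ?_⟩
      exact hE.eq_of_recursion (fun i pa => f i pa (n i)) (hgmap n) fun i => (h i).symm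
    by_cases h : gmap n = g
    · simp only [if_pos h, if_pos (key.1 h _)]
    · obtain ⟨i, hi⟩ := not_forall.1 (mt key.2 h)
      rw [if_neg h, Finset.prod_eq_zero (Finset.mem_univ i) (if_neg hi)]
end
end
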